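/- arXiv:2511.10759 — 2 statements merged into one kernel-verified Lean document; each statement's English description precedes it below -/
import Mathlib

section
/- Assume the conventions: X is an infinite, connected, locally finite, vertex-transitive simple graph satisfying (UBQ) with separation constant σ > 0. Suppose: (1) ρ is a simple bi-infinite quasi-geodesic; (2) U₁, U₂ are the two wide connected components of V ∖ N_σ(ρ(ℤ)); (3) (w₁, w₂) is a pair of witnesses for ρ with wᵢ(ℕ) ⊆ Uᵢ for i = 1,2; (4) p is a finite path from w₁(0) to w₂(0), and K = N_{10σ}(p(∗)) where p(∗) is the vertex set of p; (5) a₋ < a₊ are integers with ρ(t) ∉ K for all t ≥ a₊ and all t ≤ a₋, and ρ(a₊ − 1) ∈ K, ρ(a₋ + 1) ∈ K, and ρ₊ := ρ([a₊,∞)), ρ₋ := ρ((−∞,a₋]); (6) q is a finite path from a vertex of ρ₊ to a vertex of ρ₋ whose vertex set is disjoint from K. Then w₁(ℕ) or w₂(ℕ) intersects N_σ(q(∗)). -/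
open SimpleGraph

/-- Closed `r`-neighbourhood of a set `A` in the graph metric of `X`. -/
def gnbhd {V : Type*} (X : SimpleGraph V) (A : Set V) (r : ℝ) : Set V :=
  {v : V | ∃ a ∈ A, (X.dist v a : ℝ) ≤ r}

/-- The induced subgraph on `Z` is connected. -/
def ConnSet {V : Type*} (X : SimpleGraph V) (Z : Set V) : Prop :=
  (X.induce Z).Connected

/-- `U` is a connected component of the subset `S` of the vertex set: `U` is a
nonempty connected subset of `S` which is maximal among connected subsets of `S`. -/
def IsCompOf {V : Type*} (X : SimpleGraph V) (U S : Set V) : Prop :=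
  U ⊆ S ∧ U.Nonempty ∧ ConnSet X U ∧
    ∀ U' : Set V, U ⊆ U' → U' ⊆ S → ConnSet X U' → U' = U

/-- A subset `Z` is narrow if it is quasi-isometric to a subset of `ℝ`
with respect to the ambient graph metric. -/
def Narrow {V : Type*} (X : SimpleGraph V) (Z : Set V) : Prop :=
  ∃ (lam c : ℝ) (f : Z → ℝ), 1 ≤ lam ∧ 0 ≤ c ∧
    ∀ x y : Z, |f x - f y| ≤ lam * (X.dist x.1 y.1 : ℝ) + c ∧
      (X.dist x.1 y.1 : ℝ) ≤ lam * |f x - f y| + c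

/-- A subset is wide if it is not narrow. -/
def Wide {V : Type*} (X : SimpleGraph V) (Z : Set V) : Prop := ¬ Narrow X Z

/-- `ρ : ℤ → V` is a bi-infinite `(lam, c)`-quasi-geodesic path. -/
def IsBiQG {V : Type*} (X : SimpleGraph V) (lam c : ℝ) (ρ : ℤ → V) : Prop :=
  (∀ n : ℤ, X.Adj (ρ n) (ρ (n + 1))) ∧
    ∀ s t : ℤ, |(s : ℝ) - (t : ℝ)| / lam - c ≤ (X.dist (ρ s) (ρ t) : ℝ)

/-- A bi-infinite quasi-geodesic: a bi-infinite path which is a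
`(lam, c)`-quasi-geodesic for some `lam ≥ 1`, `c ≥ 0`. -/
def IsBiQuasiGeodesic {V : Type*} (X : SimpleGraph V) (ρ : ℤ → V) : Prop :=
  ∃ lam c : ℝ, 1 ≤ lam ∧ 0 ≤ c ∧ IsBiQG X lam c ρ

/-- The subset `S` has exactly two wide connected components. -/
def TwoWideComps {V : Type*} (X : SimpleGraph V) (S : Set V) : Prop :=
  ∃ U₁ U₂ : Set V, U₁ ≠ U₂ ∧
    IsCompOf X U₁ S ∧ IsCompOf X U₂ S ∧ Wide X U₁ ∧ Wide X U₂ ∧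
    ∀ U : Set V, IsCompOf X U S → Wide X U → U = U₁ ∨ U = U₂

/-- The uniformly bisecting quasi-geodesics property with separation constant `σ`. -/
def UBQ {V : Type*} (X : SimpleGraph V) (σ : ℝ) : Prop :=
  ∀ ρ : ℤ → V, IsBiQuasiGeodesic X ρ →
    TwoWideComps X ((gnbhd X (Set.range ρ) σ)ᶜ)

/-- One-way infinite path. -/
def IsRay {V : Type*} (X : SimpleGraph V) (w : ℕ → V) : Prop :=
  ∀ n : ℕ, X.Adj (w n) (w (n + 1))

/-- `d(w t, A) → ∞` as `t → ∞`. -/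
def DivergesFrom {V : Type*} (X : SimpleGraph V) (w : ℕ → V) (A : Set V) : Prop :=
  ∀ M : ℝ, ∃ N : ℕ, ∀ t : ℕ, N ≤ t → ∀ a ∈ A, M < (X.dist (w t) a : ℝ)

/-- `(w₁, w₂)` is a pair of witnesses for the bi-infinite quasi-geodesic `ρ`:
they are one-way infinite simple paths lying in distinct wide components of the
complement of `N_σ(ρ(ℤ))`, both diverging from `ρ`. -/
def WitnessPair {V : Type*} (X : SimpleGraph V) (σ : ℝ) (ρ : ℤ → V)
    (w₁ w₂ : ℕ → V) : Prop :=
  IsRay X w₁ ∧ Function.Injective w₁ ∧ IsRay X w₂ ∧ Function.Injective w₂ ∧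
  (∃ U₁ U₂ : Set V, U₁ ≠ U₂ ∧
    IsCompOf X U₁ ((gnbhd X (Set.range ρ) σ)ᶜ) ∧ Wide X U₁ ∧
    IsCompOf X U₂ ((gnbhd X (Set.range ρ) σ)ᶜ) ∧ Wide X U₂ ∧
    Set.range w₁ ⊆ U₁ ∧ Set.range w₂ ⊆ U₂) ∧
  DivergesFrom X w₁ (Set.range ρ) ∧ DivergesFrom X w₂ (Set.range ρ)

/-- Concatenation of the reversal of the ray `a` with the ray `b`, as a
bi-infinite path (`t ↦ a (-t)` for `t ≤ 0` and `t ↦ b t` for `t ≥ 0`). -/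
def biconcat {V : Type*} (a b : ℕ → V) : ℤ → V :=
  fun t => if t < 0 then a (-t).toNat else b t.toNat

/-- One-way infinite `(lam, c)`-quasi-geodesic ray. -/
def IsQGRay {V : Type*} (X : SimpleGraph V) (lam c : ℝ) (γ : ℕ → V) : Prop :=
  IsRay X γ ∧
    ∀ s t : ℕ, |(s : ℝ) - (t : ℝ)| / lam - c ≤ (X.dist (γ s) (γ t) : ℝ)

/-- An `(R, r, lam, c)`-cross-examiner, with the three rays `γ i`, the three
witnesses `w i` and the three finite paths `q i` (of length `qn i`) indexed by
`ZMod 3` (where the paper's index `3` corresponds to `0 : ZMod 3`). -/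
def IsCrossExaminer {V : Type*} (X : SimpleGraph V) (σ R r lam c : ℝ) (v₀ : V)
    (γ w : ZMod 3 → ℕ → V) (q : ZMod 3 → ℕ → V) (qn : ZMod 3 → ℕ) : Prop :=
  1 ≤ lam ∧ 0 ≤ c ∧ 10 * σ < r ∧ r < R ∧
  (∀ i : ZMod 3, IsQGRay X lam c (γ i) ∧ γ i 0 = v₀ ∧ IsRay X (w i) ∧
    (∀ j : ℕ, j < qn i → X.Adj (q i j) (q i (j + 1)))) ∧
  ∀ i : ZMod 3,
    -- (CE1)
    IsBiQG X lam c (biconcat (γ (i + 1)) (γ (i + 2))) ∧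
    -- (CE2)
    (∃ U : Set V,
      IsCompOf X U (Set.range (biconcat (γ (i + 1)) (γ (i + 2))) \
        gnbhd X (q 0 '' Set.Iic (qn 0) ∪ q 1 '' Set.Iic (qn 1) ∪ q 2 '' Set.Iic (qn 2))
          (10 * σ)) ∧ w i 0 ∈ U ∧ v₀ ∈ U) ∧
    -- (CE3)
    WitnessPair X σ (biconcat (γ (i + 1)) (γ (i + 2))) (w i) (γ i) ∧
    -- (CE4)
    (∀ t : ℕ, r < (t : ℝ) → ∀ s : ℤ,
      10 * σ < (X.dist (w i t) (biconcat (γ (i + 1)) (γ (i + 2)) s) : ℝ)) ∧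
    -- (CE5)
    (q i 0 ∈ Set.range (γ (i + 1)) ∧ q i (qn i) ∈ Set.range (γ (i + 2)) ∧
      (q i '' Set.Iic (qn i)) ∩
        gnbhd X (Set.range (w (i + 1)) ∪ Set.range (w (i + 2)) ∪ Set.range (γ i))
          (10 * σ) = ∅) ∧
    -- (CE6)
    q i '' Set.Iic (qn i) ⊆ gnbhd X {v₀} (R - 10 * σ) \ gnbhd X {v₀} (r + 10 * σ)

/-- `X` has quadratic growth. -/
def QuadGrowth {V : Type*} (X : SimpleGraph V) : Prop :=
  ∃ C : ℝ, 0 < C ∧ ∀ v : V, ∀ n : ℕ, 1 ≤ n →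
    ({u : V | X.dist u v ≤ n}.ncard : ℝ) ≤ C * (n : ℝ) ^ 2

/-- The set of vertices at distance exactly `1` from `A`. -/
def vertexBoundary {V : Type*} (X : SimpleGraph V) (A : Set V) : Set V :=
  {v : V | v ∉ A ∧ ∃ a ∈ A, X.Adj v a}

/-- The depth of `A`: `inf {r ≥ 0 : A ⊆ N_r(∂A)}`. -/
noncomputable def gdepth {V : Type*} (X : SimpleGraph V) (A : Set V) : ℝ :=
  sInf {r : ℝ | 0 ≤ r ∧ A ⊆ gnbhd X (vertexBoundary X A) r}

/-- A `(lam, c)`-quasi-circle of length `n ≥ 1`: a closed path all of whose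
subpaths of length at most `n / 2` are `(lam, c)`-quasi-geodesics. -/
def IsQuasiCircle {V : Type*} (X : SimpleGraph V) (lam c : ℝ) (n : ℕ)
    (C : ZMod n → V) : Prop :=
  1 ≤ n ∧ (∀ k : ZMod n, X.Adj (C k) (C (k + 1))) ∧
    ∀ (k : ZMod n) (m s t : ℕ), 2 * m ≤ n → s ≤ m → t ≤ m →
      |(s : ℝ) - (t : ℝ)| / lam - c ≤
        (X.dist (C (k + (s : ZMod n))) (C (k + (t : ZMod n))) : ℝ)

/-- A truncated `(lam, c)`-quasi-circle with major face `F` (of length `nF`) and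
minor face `f` (of length `nf`): `F` is the initial part of a `(lam, c)`-quasi-circle
and `f` is a `(lam, c)`-quasi-geodesic with the same endpoints as the remaining part. -/
def IsTruncQuasiCircle {V : Type*} (X : SimpleGraph V) (lam c : ℝ)
    (F : ℕ → V) (nF : ℕ) (f : ℕ → V) (nf : ℕ) : Prop :=
  (∀ i : ℕ, i < nF → X.Adj (F i) (F (i + 1))) ∧
  (∀ i : ℕ, i < nf → X.Adj (f i) (f (i + 1))) ∧
  f 0 = F nF ∧ f nf = F 0 ∧
  (∀ s t : ℕ, s ≤ nf → t ≤ nf →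
    |(s : ℝ) - (t : ℝ)| / lam - c ≤ (X.dist (f s) (f t) : ℝ)) ∧
  ∃ (n : ℕ) (C : ZMod n → V), IsQuasiCircle X lam c n C ∧ nF ≤ n ∧
    ∀ i : ℕ, i ≤ nF → C (i : ZMod n) = F i

/-- The graph `X`, with its graph metric, is quasi-isometric to the metric space `Y`. -/
def QIto {V : Type*} (X : SimpleGraph V) (Y : Type*) [PseudoMetricSpace Y] : Prop :=
  ∃ (lam c : ℝ) (f : V → Y), 1 ≤ lam ∧ 0 ≤ c ∧
    (∀ x x' : V, (X.dist x x' : ℝ) / lam - c ≤ dist (f x) (f x') ∧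
      dist (f x) (f x') ≤ lam * (X.dist x x' : ℝ) + c) ∧
    ∀ y : Y, ∃ x : V, dist y (f x) ≤ c

/-- The Gromov product `(x · y)_w` in the graph metric. -/
noncomputable def gromovProd {V : Type*} (X : SimpleGraph V) (w x y : V) : ℝ :=
  ((X.dist x w : ℝ) + (X.dist y w : ℝ) - (X.dist x y : ℝ)) / 2

/-- `X` is Gromov hyperbolic. -/
def GromovHyperbolic {V : Type*} (X : SimpleGraph V) : Prop :=
  ∃ δ : ℝ, 0 ≤ δ ∧ ∀ w x y z : V,
    min (gromovProd X w x z) (gromovProd X w y z) - δ ≤ gromovProd X w x y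

/-- `x` and `y` are joined by a walk of `X` which stays inside `S`. -/
def WalkIn {V : Type*} (X : SimpleGraph V) (S : Set V) (x y : V) : Prop :=
  ∃ W : X.Walk x y, ∀ v ∈ W.support, v ∈ S

/-- The connected component of `x` in `S`. -/
def compAt {V : Type*} (X : SimpleGraph V) (S : Set V) (x : V) : Set V :=
  {y | WalkIn X S x y}

section

variable {V : Type*} {X : SimpleGraph V} {S T A B U : Set V} {x y z : V}

theorem WalkIn.refl (h : x ∈ S) : WalkIn X S x x :=
  ⟨Walk.nil, by simpa using h⟩

theorem WalkIn.symm (h : WalkIn X S x y) : WalkIn X S y x := by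
  obtain ⟨W, hW⟩ := h
  exact ⟨W.reverse, by simpa using hW⟩

theorem WalkIn.trans (h : WalkIn X S x y) (h' : WalkIn X S y z) : WalkIn X S x z := by
  obtain ⟨W, hW⟩ := h
  obtain ⟨W', hW'⟩ := h'
  refine ⟨W.append W', fun v hv => ?_⟩
  rcases (Walk.mem_support_append_iff _ _).1 hv with hv | hv
  exacts [hW v hv, hW' v hv]

theorem WalkIn.mono (hST : S ⊆ T) (h : WalkIn X S x y) : WalkIn X T x y := by
  obtain ⟨W, hW⟩ := h
  exact ⟨W, fun v hv => hST (hW v hv)⟩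

theorem WalkIn.of_adj (h : X.Adj x y) (hx : x ∈ S) (hy : y ∈ S) : WalkIn X S x y :=
  ⟨h.toWalk, by simp [hx, hy]⟩

theorem WalkIn.left_mem (h : WalkIn X S x y) : x ∈ S := by
  obtain ⟨W, hW⟩ := h
  exact hW _ W.start_mem_support

theorem WalkIn.right_mem (h : WalkIn X S x y) : y ∈ S := h.symm.left_mem

theorem compAt_subset : compAt X S x ⊆ S := fun _ h => WalkIn.right_mem h

theorem mem_compAt_self (h : x ∈ S) : x ∈ compAt X S x := WalkIn.refl h

theorem compAt_eq_of_mem (h : y ∈ compAt X S x) : compAt X S y = compAt X S x :=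
  Set.ext fun _ => ⟨fun hz => WalkIn.trans h hz, fun hz => (WalkIn.symm h).trans hz⟩

theorem exists_walk_of_path {p : ℕ → V} {n : ℕ} (hp : ∀ i < n, X.Adj (p i) (p (i + 1))) :
    ∃ W : X.Walk (p 0) (p n), ∀ v, v ∈ W.support ↔ v ∈ p '' Set.Iic n := by
  induction n with
  | zero => exact ⟨Walk.nil, by simp [Set.Iic]⟩
  | succ n ih =>
    obtain ⟨W, hW⟩ := ih fun i hi => hp i (by omega)
    refine ⟨W.concat (hp n (by omega)), fun v => ?_⟩
    rw [Walk.support_concat, List.mem_append, List.mem_singleton, hW]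
    constructor
    · rintro (⟨i, hi, rfl⟩ | rfl)
      · exact ⟨i, Nat.le_succ_of_le hi, rfl⟩
      · exact ⟨n + 1, Set.mem_Iic.2 le_rfl, rfl⟩
    · rintro ⟨i, hi, rfl⟩
      rcases Nat.le_succ_iff.1 hi with hi | rfl
      · exact Or.inl ⟨i, hi, rfl⟩
      · exact Or.inr rfl

theorem IsRay.walkIn {w : ℕ → V} (hw : IsRay X w) (hS : Set.range w ⊆ S) (n : ℕ) :
    WalkIn X S (w 0) (w n) := by
  obtain ⟨W, hW⟩ := exists_walk_of_path (n := n) fun i _ => hw i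
  exact ⟨W, fun v hv => hS (Set.image_subset_range _ _ ((hW v).1 hv))⟩

theorem ConnSet.walkIn (h : ConnSet X S) (hx : x ∈ S) (hy : y ∈ S) : WalkIn X S x y := by
  obtain ⟨W⟩ := h.preconnected ⟨x, hx⟩ ⟨y, hy⟩
  suffices h : ∀ v ∈ (W.map (Embedding.induce S).toHom).support, v ∈ S from
    ⟨W.map (Embedding.induce S).toHom, h⟩
  intro v hv
  rw [Walk.support_map, List.mem_map] at hv
  obtain ⟨u, -, rfl⟩ := hv
  exact u.2

theorem connSet_compAt (hx : x ∈ S) : ConnSet X (compAt X S x) := by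
  have key : ∀ y (hy : y ∈ compAt X S x),
      (X.induce (compAt X S x)).Reachable ⟨x, mem_compAt_self hx⟩ ⟨y, hy⟩ := by
    rintro y ⟨W, hW⟩
    classical
    have h : ∀ v ∈ W.support, v ∈ compAt X S x := fun v hv =>
      ⟨W.takeUntil v hv, fun u hu => hW u (W.support_takeUntil_subset_support hv hu)⟩
    exact ⟨W.induce _ h⟩
  have : Nonempty (compAt X S x) := ⟨⟨x, mem_compAt_self hx⟩⟩
  exact ⟨fun a b => (key a a.2).symm.trans (key b b.2)⟩

theorem isCompOf_compAt (hx : x ∈ S) : IsCompOf X (compAt X S x) S :=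
  ⟨compAt_subset, ⟨x, mem_compAt_self hx⟩, connSet_compAt hx, fun _ h₁ h₂ h₃ =>
    (Set.Subset.antisymm h₁ fun _ hy => (h₃.walkIn (h₁ (mem_compAt_self hx)) hy).mono h₂).symm⟩

theorem IsCompOf.eq_compAt (h : IsCompOf X U S) (hx : x ∈ U) : U = compAt X S x :=
  (h.2.2.2 _ (fun _ hy => (h.2.2.1.walkIn hx hy).mono h.1) compAt_subset
    (connSet_compAt (h.1 hx))).symm

theorem gnbhd_mono {r : ℝ} (h : A ⊆ B) : gnbhd X A r ⊆ gnbhd X B r :=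
  fun _ ⟨a, ha, hd⟩ => ⟨a, h ha, hd⟩

theorem Narrow.mono (h : Narrow X B) (hAB : A ⊆ B) : Narrow X A := by
  obtain ⟨lam, c, f, hl, hc, hf⟩ := h
  exact ⟨lam, c, fun a => f ⟨a, hAB a.2⟩, hl, hc, fun a b => hf ⟨a, hAB a.2⟩ ⟨b, hAB b.2⟩⟩

theorem SimpleGraph.Iso.dist_apply (φ : X ≃g X) (u v : V) :
    X.dist (φ u) (φ v) = X.dist u v := by
  have key : ∀ (ψ : X ≃g X) (a b : V), X.edist (ψ a) (ψ b) ≤ X.edist a b := by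
    intro ψ a b
    by_cases h : X.edist a b = ⊤
    · simp [h]
    · obtain ⟨W, hW⟩ := exists_walk_of_edist_ne_top h
      rw [← hW]
      simpa using edist_le (W.map ψ.toHom)
  have h₂ := key φ.symm (φ u) (φ v)
  rw [φ.symm_apply_apply, φ.symm_apply_apply] at h₂
  exact congrArg ENat.toNat (le_antisymm (key φ u v) h₂)

/-- In a vertex-transitive graph, a narrow set containing arbitrarily large balls forces
the whole graph to be narrow. -/
theorem narrow_univ_of_balls (hconn : X.Connected) (htrans : ∀ u v : V, ∃ φ : X ≃g X, φ u = v)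
    (hA : Narrow X A) (hb : ∀ n : ℕ, ∃ x, ∀ y, X.dist x y ≤ n → y ∈ A) :
    Narrow X Set.univ := by
  classical
  obtain ⟨lam, c, f, hl, hc, hf⟩ := hA
  choose x hx using hb
  obtain ⟨v₀⟩ := hconn.nonempty
  choose φ hφ using fun n => htrans v₀ (x n)
  let F : V → ℝ := fun v => if h : v ∈ A then f ⟨v, h⟩ else 0
  have hF : ∀ u ∈ A, ∀ v ∈ A, |F u - F v| ≤ lam * (X.dist u v : ℝ) + c ∧
      (X.dist u v : ℝ) ≤ lam * |F u - F v| + c := by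
    intro u hu v hv
    simpa [F, hu, hv] using hf ⟨u, hu⟩ ⟨v, hv⟩
  let 𝒰 : Ultrafilter ℕ := Ultrafilter.of Filter.atTop
  have hmem : ∀ v, ∀ᶠ n in (𝒰 : Filter ℕ), φ n v ∈ A := by
    intro v
    refine Ultrafilter.of_le _ (Filter.eventually_atTop.2 ⟨X.dist v₀ v, fun n hn => hx n _ ?_⟩)
    rwa [← hφ n, Iso.dist_apply]
  let g : ℕ → V → ℝ := fun n v => F (φ n v) - F (φ n v₀)
  have hg : ∀ u v, ∀ᶠ n in (𝒰 : Filter ℕ), |g n u - g n v| ≤ lam * (X.dist u v : ℝ) + c ∧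
      (X.dist u v : ℝ) ≤ lam * |g n u - g n v| + c := by
    intro u v
    filter_upwards [hmem u, hmem v] with n hu hv
    have := hF _ hu _ hv
    rw [Iso.dist_apply] at this
    simpa [g] using this
  have hlim : ∀ v, ∃ l, Filter.Tendsto (fun n => g n v) 𝒰 (nhds l) := by
    intro v
    have hc : IsCompact (Metric.closedBall (0 : ℝ) (lam * (X.dist v v₀ : ℝ) + c)) :=
      isCompact_closedBall _ _
    obtain ⟨l, -, h⟩ := hc.ultrafilter_le_nhds (𝒰.map fun n => g n v) (by
      rw [Filter.le_principal_iff]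
      exact (hg v v₀).mono fun n hn => by simpa [g] using hn.1)
    exact ⟨l, h⟩
  choose G hG using hlim
  refine ⟨lam, c, fun v => G v, hl, hc, fun u v => ?_⟩
  have ht := ((hG u).sub (hG v)).abs
  exact ⟨le_of_tendsto ht ((hg u v).mono fun _ h => h.1),
    ge_of_tendsto ((ht.const_mul lam).add_const c) ((hg u v).mono fun _ h => h.2)⟩

/-- A narrow component of the complement of `N_σ(R)` stays within bounded distance of `R`. -/
theorem Narrow.subset_gnbhd (hconn : X.Connected)
    (htrans : ∀ u v : V, ∃ φ : X ≃g X, φ u = v) (hV : Wide X Set.univ) {R : Set V} {σ : ℝ}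
    (h : Narrow X (compAt X (gnbhd X R σ)ᶜ x)) :
    ∃ M : ℝ, compAt X (gnbhd X R σ)ᶜ x ⊆ gnbhd X R M := by
  by_contra! hcon
  refine hV (narrow_univ_of_balls hconn htrans h fun n => ?_)
  obtain ⟨y, hy, hyR⟩ := Set.not_subset.1 (hcon (n + σ))
  refine ⟨y, fun z hz => ?_⟩
  obtain ⟨W, hW⟩ := hconn.exists_walk_length_eq_dist y z
  refine WalkIn.trans hy ⟨W, ?_⟩
  rintro v hv ⟨a, ha, hav⟩
  classical
  have h₁ : X.dist y v ≤ n :=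
    (dist_le (W.takeUntil v hv)).trans ((W.length_takeUntil_le_length hv).trans (hW ▸ hz))
  have h₂ : (X.dist y a : ℝ) ≤ X.dist y v + X.dist v a := by
    exact_mod_cast hconn.dist_triangle
  have h₃ : (X.dist y v : ℝ) ≤ n := by exact_mod_cast h₁
  exact hyR ⟨a, ha, by linarith⟩

theorem finite_setOf_dist_le (hconn : X.Connected) (hlf : ∀ v : V, (X.neighborSet v).Finite)
    (a : V) (n : ℕ) : {v | X.dist a v ≤ n}.Finite := by
  induction n with
  | zero =>
    refine (Set.finite_singleton a).subset fun v hv => ?_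
    exact (hconn.dist_eq_zero_iff.1 (Nat.le_zero.1 hv)).symm
  | succ n ih =>
    refine (ih.union (ih.biUnion fun v _ => hlf v)).subset fun v hv => ?_
    obtain ⟨W, hW⟩ := hconn.exists_walk_length_eq_dist v a
    cases W with
    | nil => left; simp
    | cons h W =>
      rename_i u
      rw [Walk.length_cons] at hW
      have h₁ := dist_le W
      have h₂ : X.dist a v ≤ n + 1 := hv
      rw [dist_comm] at h₁ h₂
      refine Or.inr (Set.mem_biUnion (x := u) ?_ h.symm)
      change X.dist a u ≤ n
      omega

theorem finite_gnbhd (hconn : X.Connected) (hlf : ∀ v : V, (X.neighborSet v).Finite)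
    (hA : A.Finite) (r : ℝ) : (gnbhd X A r).Finite := by
  refine (hA.biUnion fun a _ => finite_setOf_dist_le hconn hlf a ⌊r⌋₊).subset ?_
  rintro v ⟨a, ha, hd⟩
  refine Set.mem_biUnion ha ?_
  rw [dist_comm] at hd
  exact Nat.le_floor hd

theorem IsBiQG.dist_le (hconn : X.Connected) {lam c : ℝ} {ρ : ℤ → V} (hρ : IsBiQG X lam c ρ)
    (s t : ℤ) : X.dist (ρ s) (ρ t) ≤ (s - t).natAbs := by
  have key : ∀ (s : ℤ) (k : ℕ), X.dist (ρ s) (ρ (s + k)) ≤ k := by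
    intro s k
    induction k with
    | zero => simp
    | succ k ih =>
      have h₁ := dist_eq_one_iff_adj.2 (hρ.1 (s + k))
      have h₂ : X.dist (ρ s) (ρ (s + k + 1)) ≤ _ := hconn.dist_triangle (v := ρ (s + k))
      rw [Nat.cast_succ, ← add_assoc]
      omega
  rcases le_total s t with h | h
  · obtain ⟨k, rfl⟩ := Int.le.dest h
    simpa using key s k
  · obtain ⟨k, rfl⟩ := Int.le.dest h
    rw [dist_comm]
    simpa using key t k

theorem IsBiQuasiGeodesic.narrow_gnbhd (hconn : X.Connected) {ρ : ℤ → V}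
    (hρ : IsBiQuasiGeodesic X ρ) (M : ℝ) : Narrow X (gnbhd X (Set.range ρ) M) := by
  obtain ⟨lam, c, hl, hc, hρ⟩ := hρ
  have ht : ∀ x : gnbhd X (Set.range ρ) M, ∃ t : ℤ, (X.dist x.1 (ρ t) : ℝ) ≤ |M| := by
    rintro ⟨x, _, ⟨t, rfl⟩, h⟩
    exact ⟨t, h.trans (le_abs_self M)⟩
  choose t ht using ht
  have hM := abs_nonneg M
  have hl₀ : 0 < lam := by linarith
  refine ⟨lam, lam * (2 * |M| + c) + 2 * |M|, fun x => t x, hl, by positivity, fun x y => ?_⟩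
  have hx := ht x
  have hy := ht y
  have tri : ∀ a b d : V, (X.dist a d : ℝ) ≤ X.dist a b + X.dist b d := fun a b d => by
    exact_mod_cast hconn.dist_triangle
  have h₁ := tri (ρ (t x)) x (ρ (t y))
  have h₂ := tri x y (ρ (t y))
  have h₃ := tri x (ρ (t x)) y
  have h₄ := tri (ρ (t x)) (ρ (t y)) y
  rw [dist_comm (u := ρ (t x)) (v := x)] at h₁
  rw [dist_comm (u := ρ (t y)) (v := y)] at h₄
  have h₅ := hρ.2 (t x) (t y)
  have h₆ : (X.dist (ρ (t x)) (ρ (t y)) : ℝ) ≤ |(t x : ℝ) - t y| := by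
    have := hρ.dist_le hconn (t x) (t y)
    have h : ((X.dist (ρ (t x)) (ρ (t y)) : ℤ) : ℝ) ≤ ((t x - t y).natAbs : ℤ) := by
      exact_mod_cast this
    simpa using h
  rw [sub_le_iff_le_add, div_le_iff₀ hl₀] at h₅
  constructor
  · nlinarith
  · nlinarith [abs_nonneg ((t x : ℝ) - t y), mul_nonneg hl₀.le hM, mul_nonneg hl₀.le hc]

/-- Replacing a finite segment of a bi-infinite quasi-geodesic by an arbitrary finite walk
yields a bi-infinite quasi-geodesic at bounded distance from the original one. -/
theorem IsBiQuasiGeodesic.exists_detour (hconn : X.Connected) {ρ : ℤ → V}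
    (hρ : IsBiQuasiGeodesic X ρ) {a b : ℤ} (W : X.Walk (ρ a) (ρ b)) :
    ∃ τ : ℤ → V, IsBiQuasiGeodesic X τ ∧
      Set.range τ = ρ '' Set.Iic a ∪ {v | v ∈ W.support} ∪ ρ '' Set.Ici b ∧
      ∃ D : ℕ, ∀ t, X.dist (τ t) (ρ t) ≤ D := by
  obtain ⟨lam, c, hl, hc, hρ⟩ := hρ
  let τ : ℤ → V := fun t =>
    if t ≤ 0 then ρ (t + a) else if t ≤ W.length then W.getVert t.toNat else ρ (b + t - W.length)
  have hneg : ∀ t ≤ 0, τ t = ρ (t + a) := fun t ht => if_pos ht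
  have hmid : ∀ i ≤ W.length, τ i = W.getVert i := by
    intro i hi
    rcases Nat.eq_zero_or_pos i with rfl | h
    · simp [τ]
    · have h₁ : ¬ ((i : ℤ) ≤ 0) := by omega
      have h₂ : (i : ℤ) ≤ W.length := by omega
      simp [τ, h₂]
      intro h
      omega
  have hpos : ∀ t : ℤ, W.length ≤ t → τ t = ρ (b + t - W.length) := by
    intro t ht
    rcases ht.eq_or_lt with rfl | h
    · rw [hmid _ le_rfl]
      simp
    · have h₁ : ¬ (t ≤ 0) := by omega
      have h₂ : ¬ (t ≤ W.length) := by omega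
      simp only [τ, if_neg h₁, if_neg h₂]
  have hcases : ∀ t : ℤ, t ≤ 0 ∨ (∃ i ≤ W.length, t = (i : ℕ)) ∨ (W.length : ℤ) ≤ t := by
    intro t
    by_cases h₁ : t ≤ 0
    · exact Or.inl h₁
    by_cases h₂ : (W.length : ℤ) ≤ t
    · exact Or.inr (Or.inr h₂)
    · exact Or.inr (Or.inl ⟨t.toNat, by omega, by omega⟩)
  have hD : ∀ t, X.dist (τ t) (ρ t) ≤ a.natAbs + b.natAbs + 2 * W.length := by
    intro t
    rcases hcases t with h | ⟨i, hi, rfl⟩ | h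
    · rw [hneg t h]
      have := hρ.dist_le hconn (t + a) t
      omega
    · rw [hmid i hi]
      have h₁ : X.dist (W.getVert i) (ρ a) ≤ (W.take i).length := by
        rw [dist_comm]
        exact SimpleGraph.dist_le _
      have h₂ := hρ.dist_le hconn a i
      have h₃ : X.dist (W.getVert i) (ρ i) ≤ _ := hconn.dist_triangle (v := ρ a)
      have h₄ : (W.take i).length ≤ W.length := by simp
      omega
    · rw [hpos t h]
      have := hρ.dist_le hconn (b + t - W.length) t
      omega
  refine ⟨τ, ⟨lam, c + 2 * (a.natAbs + b.natAbs + 2 * W.length : ℕ), hl, by positivity,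
    fun t => ?_, fun s t => ?_⟩, ?_, _, hD⟩
  · rcases lt_or_ge t 0 with h | h
    · rw [hneg t h.le, hneg (t + 1) h, add_right_comm]
      exact hρ.1 _
    · lift t to ℕ using h
      rcases lt_or_ge t W.length with h | h
      · rw [hmid t h.le, ← Nat.cast_succ, hmid _ h]
        exact W.adj_getVert_succ h
      · rw [hpos t (by omega), hpos (t + 1) (by omega),
          show b + ((t : ℤ) + 1) - W.length = b + t - W.length + 1 by ring]
        exact hρ.1 _
  · have h₁ : X.dist (ρ s) (ρ t) ≤ X.dist (τ s) (ρ s) + X.dist (τ s) (ρ t) := by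
      rw [dist_comm (u := τ s) (v := ρ s)]
      exact hconn.dist_triangle
    have h₂ : X.dist (τ s) (ρ t) ≤ X.dist (τ s) (τ t) + X.dist (τ t) (ρ t) := hconn.dist_triangle
    have h₃ : X.dist (ρ s) (ρ t) ≤
        X.dist (τ s) (τ t) + 2 * (a.natAbs + b.natAbs + 2 * W.length) := by
      have := hD s
      have := hD t
      omega
    have h₄ : (X.dist (ρ s) (ρ t) : ℝ) ≤
        X.dist (τ s) (τ t) + 2 * (a.natAbs + b.natAbs + 2 * W.length : ℕ) := by
      exact_mod_cast h₃
    have := hρ.2 s t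
    linarith
  · ext v
    constructor
    · rintro ⟨t, rfl⟩
      rcases hcases t with h | ⟨i, hi, rfl⟩ | h
      · rw [hneg t h]
        exact Or.inl (Or.inl ⟨_, by simpa using h, rfl⟩)
      · rw [hmid i hi]
        exact Or.inl (Or.inr (W.getVert_mem_support i))
      · rw [hpos t h]
        refine Or.inr ⟨_, ?_, rfl⟩
        rw [Set.mem_Ici]
        omega
    · rintro ((⟨t, ht, rfl⟩ | hv) | ⟨t, ht, rfl⟩)
      · rw [Set.mem_Iic] at ht
        exact ⟨t - a, by rw [hneg _ (by omega), sub_add_cancel]⟩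
      · obtain ⟨i, rfl, hi⟩ := Walk.mem_support_iff_exists_getVert.1 hv
        exact ⟨i, hmid i hi⟩
      · rw [Set.mem_Ici] at ht
        refine ⟨t - b + W.length, ?_⟩
        rw [hpos _ (by omega)]
        congr 1
        ring

/-- If the `σ`-neighbourhoods of `R' ⊆ R` differ by a finite set, then a component of the
complement of the smaller one, all of whose pieces in the complement of the larger one stay
near `R`, itself stays near `R`. -/
theorem compAt_subset_gnbhd_of_pieces (hlf : ∀ v : V, (X.neighborSet v).Finite) {R R' : Set V}
    {σ : ℝ} (hfin : (gnbhd X R σ \ gnbhd X R' σ).Finite)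
    (h : ∀ g ∈ compAt X (gnbhd X R' σ)ᶜ x, g ∉ gnbhd X R σ →
      ∃ M, compAt X (gnbhd X R σ)ᶜ g ⊆ gnbhd X R M) :
    ∃ M, compAt X (gnbhd X R' σ)ᶜ x ⊆ gnbhd X R M := by
  have hM : ∀ g, ∃ M, g ∈ compAt X (gnbhd X R' σ)ᶜ x → g ∉ gnbhd X R σ →
      compAt X (gnbhd X R σ)ᶜ g ⊆ gnbhd X R M := by
    intro g
    by_cases hg : g ∈ compAt X (gnbhd X R' σ)ᶜ x ∧ g ∉ gnbhd X R σ
    · obtain ⟨M, hM⟩ := h g hg.1 hg.2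
      exact ⟨M, fun _ _ => hM⟩
    · exact ⟨0, fun h₁ h₂ => absurd ⟨h₁, h₂⟩ hg⟩
  choose M hM using hM
  let G : Set V := {x} ∪ ⋃ f ∈ gnbhd X R σ \ gnbhd X R' σ, X.neighborSet f
  have hG : G.Finite := (Set.finite_singleton x).union (hfin.biUnion fun f _ => hlf f)
  obtain ⟨B, hB⟩ := (hG.image M).bddAbove
  have key : ∀ {y x' : V} (W : X.Walk y x'), x' = x → (∀ v ∈ W.support, v ∈ (gnbhd X R' σ)ᶜ) →
      y ∈ gnbhd X R σ ∨ ∃ g ∈ G, g ∈ compAt X (gnbhd X R' σ)ᶜ x ∧ g ∉ gnbhd X R σ ∧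
        y ∈ compAt X (gnbhd X R σ)ᶜ g := by
    intro y x' W hx' hW
    induction W with
    | nil =>
      rename_i u
      subst hx'
      by_cases hu : u ∈ gnbhd X R σ
      · exact Or.inl hu
      · exact Or.inr ⟨u, Or.inl rfl, mem_compAt_self (hW u (by simp)), hu, mem_compAt_self hu⟩
    | @cons u v _ huv W ih =>
      by_cases hu : u ∈ gnbhd X R σ
      · exact Or.inl hu
      rcases ih hx' fun z hz => hW z (by simp [hz]) with hv | ⟨g, hgG, hg, hgR, hvg⟩
      · refine Or.inr ⟨u, Or.inr (Set.mem_biUnion ⟨hv, hW v (by simp)⟩ huv.symm), ?_, hu,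
          mem_compAt_self hu⟩
        subst hx'
        exact WalkIn.symm ⟨.cons huv W, hW⟩
      · exact Or.inr ⟨g, hgG, hg, hgR,
          WalkIn.trans hvg (.of_adj huv.symm (compAt_subset hvg) hu)⟩
  refine ⟨max B σ, fun y hy => ?_⟩
  obtain ⟨W, hW⟩ := WalkIn.symm hy
  rcases key W rfl hW with ⟨a, ha, hd⟩ | ⟨g, hgG, hg, hgR, hyg⟩
  · exact ⟨a, ha, hd.trans (le_max_right _ _)⟩
  · obtain ⟨a, ha, hd⟩ := hM g hg hgR hyg
    exact ⟨a, ha, hd.trans ((hB ⟨g, hgG, rfl⟩).trans (le_max_left _ _))⟩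

/-- A component containing a ray which diverges from a quasi-geodesic at bounded distance is
wide. -/
theorem DivergesFrom.wide_compAt (hconn : X.Connected)
    (htrans : ∀ u v : V, ∃ φ : X ≃g X, φ u = v) (hV : Wide X Set.univ) {ρ τ : ℤ → V} {D : ℕ}
    (hD : ∀ t, X.dist (τ t) (ρ t) ≤ D) {w : ℕ → V} (hw : IsRay X w)
    (hdiv : DivergesFrom X w (Set.range ρ)) {σ : ℝ}
    (hwτ : Set.range w ⊆ (gnbhd X (Set.range τ) σ)ᶜ) :
    Wide X (compAt X (gnbhd X (Set.range τ) σ)ᶜ (w 0)) := by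
  intro hN
  obtain ⟨M, hM⟩ := hN.subset_gnbhd hconn htrans hV
  obtain ⟨N, hN⟩ := hdiv (M + D)
  obtain ⟨_, ⟨t, rfl⟩, hd⟩ := hM (hw.walkIn hwτ N)
  have h₁ := hN N le_rfl (ρ t) ⟨t, rfl⟩
  have h₂ : (X.dist (w N) (ρ t) : ℝ) ≤ X.dist (w N) (τ t) + X.dist (τ t) (ρ t) := by
    exact_mod_cast hconn.dist_triangle
  have h₃ : (X.dist (τ t) (ρ t) : ℝ) ≤ D := by exact_mod_cast hD t
  linarith

theorem TwoWideComps.eq_or_eq (h : TwoWideComps X S) (hx : x ∈ S) (hy : y ∈ S) (hz : z ∈ S)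
    (hwx : Wide X (compAt X S x)) (hwy : Wide X (compAt X S y)) (hwz : Wide X (compAt X S z))
    (hxy : y ∉ compAt X S x) : z ∈ compAt X S x ∨ z ∈ compAt X S y := by
  obtain ⟨U₁, U₂, -, -, -, -, -, h⟩ := h
  have h₁ := h _ (isCompOf_compAt hx) hwx
  have h₂ := h _ (isCompOf_compAt hy) hwy
  have h₃ := h _ (isCompOf_compAt hz) hwz
  have hne : compAt X S x ≠ compAt X S y := fun h => hxy (h ▸ mem_compAt_self hy)
  have hz' := mem_compAt_self (X := X) hz
  grind

theorem TwoWideComps.exists_other (h : TwoWideComps X S) (A : Set V) :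
    ∃ x, Wide X (compAt X S x) ∧ compAt X S x ≠ A := by
  obtain ⟨U₁, U₂, hne, h₁, h₂, hw₁, hw₂, -⟩ := h
  obtain ⟨x₁, hx₁⟩ := h₁.2.1
  obtain ⟨x₂, hx₂⟩ := h₂.2.1
  by_cases h : U₁ = A
  · exact ⟨x₂, h₂.eq_compAt hx₂ ▸ hw₂, h₂.eq_compAt hx₂ ▸ h ▸ hne.symm⟩
  · exact ⟨x₁, h₁.eq_compAt hx₁ ▸ hw₁, h₁.eq_compAt hx₁ ▸ h⟩

end

theorem statement_6 {V : Type*} (X : SimpleGraph V)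
    (hinf : Infinite V) (hconn : X.Connected)
    (hlf : ∀ v : V, (X.neighborSet v).Finite)
    (htrans : ∀ u v : V, ∃ φ : X ≃g X, φ u = v)
    (σ : ℝ) (hσ : 0 < σ) (hubq : UBQ X σ)
    (ρ : ℤ → V) (hρ : IsBiQuasiGeodesic X ρ) (hρinj : Function.Injective ρ)
    (U₁ U₂ : Set V) (hne : U₁ ≠ U₂)
    (hU₁ : IsCompOf X U₁ ((gnbhd X (Set.range ρ) σ)ᶜ)) (hU₁w : Wide X U₁)
    (hU₂ : IsCompOf X U₂ ((gnbhd X (Set.range ρ) σ)ᶜ)) (hU₂w : Wide X U₂)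
    (w₁ w₂ : ℕ → V) (hw : WitnessPair X σ ρ w₁ w₂)
    (hw₁ : Set.range w₁ ⊆ U₁) (hw₂ : Set.range w₂ ⊆ U₂)
    (p : ℕ → V) (np : ℕ) (hpadj : ∀ i : ℕ, i < np → X.Adj (p i) (p (i + 1)))
    (hp0 : p 0 = w₁ 0) (hpn : p np = w₂ 0)
    (K : Set V) (hK : K = gnbhd X (p '' Set.Iic np) (10 * σ))
    (am ap : ℤ) (ha : am < ap)
    (hap : ∀ t : ℤ, ap ≤ t → ρ t ∉ K) (ham : ∀ t : ℤ, t ≤ am → ρ t ∉ K)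
    (hap' : ρ (ap - 1) ∈ K) (ham' : ρ (am + 1) ∈ K)
    (q : ℕ → V) (nq : ℕ) (hqadj : ∀ i : ℕ, i < nq → X.Adj (q i) (q (i + 1)))
    (hq0 : ∃ s : ℤ, ap ≤ s ∧ q 0 = ρ s) (hqn : ∃ s : ℤ, s ≤ am ∧ q nq = ρ s)
    (hqK : (q '' Set.Iic nq) ∩ K = ∅) :
    (∃ t : ℕ, w₁ t ∈ gnbhd X (q '' Set.Iic nq) σ) ∨
      (∃ t : ℕ, w₂ t ∈ gnbhd X (q '' Set.Iic nq) σ) := by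
  by_contra hcon
  push Not at hcon
  obtain ⟨hc₁, hc₂⟩ := hcon
  obtain ⟨hr₁, -, hr₂, -, -, hd₁, hd₂⟩ := hw
  have hV : Wide X Set.univ := fun h => hU₁w (h.mono (Set.subset_univ _))
  obtain ⟨s, hs, hq0⟩ := hq0
  obtain ⟨t, ht, hqn⟩ := hqn
  obtain ⟨Q, hQ⟩ : ∃ Q : X.Walk (ρ s) (ρ t), ∀ v, v ∈ Q.support ↔ v ∈ q '' Set.Iic nq := by
    rw [← hq0, ← hqn]
    exact exists_walk_of_path hqadj
  obtain ⟨P, hP⟩ : ∃ P : X.Walk (w₁ 0) (w₂ 0), ∀ v, v ∈ P.support ↔ v ∈ p '' Set.Iic np := by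
    rw [← hp0, ← hpn]
    exact exists_walk_of_path hpadj
  obtain ⟨τ', hτ'qg, hτ'r, -⟩ := hρ.exists_detour hconn Q.reverse
  obtain ⟨τ, hτqg, hτr, D, hD⟩ := hρ.exists_detour hconn (Q.append Q.reverse)
  have hτ' : Set.range τ' = ρ '' Set.Iic t ∪ q '' Set.Iic nq ∪ ρ '' Set.Ici s := by
    rw [hτ'r]
    congr 2
    ext v
    rw [Set.mem_ofPred_eq, Walk.support_reverse, List.mem_reverse, hQ]
  have hτ : Set.range τ = Set.range ρ ∪ q '' Set.Iic nq := by
    have h : Set.range ρ = ρ '' Set.Iic s ∪ ρ '' Set.Ici s := by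
      rw [← Set.image_union, Set.Iic_union_Ici, Set.image_univ]
    rw [hτr, h, Set.union_right_comm]
    congr 1
    ext v
    simp [hQ]
  have hsub : Set.range τ' ⊆ Set.range τ := by
    rw [hτ', hτ]
    rintro v ((⟨r, -, rfl⟩ | hv) | ⟨r, -, rfl⟩)
    exacts [Or.inl ⟨r, rfl⟩, Or.inr hv, Or.inl ⟨r, rfl⟩]
  have hSS : (gnbhd X (Set.range τ) σ)ᶜ ⊆ (gnbhd X (Set.range τ') σ)ᶜ :=
    Set.compl_subset_compl.2 (gnbhd_mono hsub)
  have hSρ : (gnbhd X (Set.range τ) σ)ᶜ ⊆ (gnbhd X (Set.range ρ) σ)ᶜ :=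
    Set.compl_subset_compl.2 (gnbhd_mono (hτ ▸ Set.subset_union_left))
  have hwS : ∀ (w : ℕ → V) (U : Set V), Set.range w ⊆ U → U ⊆ (gnbhd X (Set.range ρ) σ)ᶜ →
      (∀ n, w n ∉ gnbhd X (q '' Set.Iic nq) σ) →
      Set.range w ⊆ (gnbhd X (Set.range τ) σ)ᶜ := by
    rintro w U hwU hU hc _ ⟨n, rfl⟩ ⟨a, ha, hd⟩
    rw [hτ] at ha
    rcases ha with ha | ha
    exacts [hU (hwU ⟨n, rfl⟩) ⟨a, ha, hd⟩, hc n ⟨a, ha, hd⟩]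
  have hS₁ := hwS w₁ U₁ hw₁ hU₁.1 hc₁
  have hS₂ := hwS w₂ U₂ hw₂ hU₂.1 hc₂
  have hB₁ := hd₁.wide_compAt hconn htrans hV hD hr₁ hS₁
  have hB₂ := hd₂.wide_compAt hconn htrans hV hD hr₂ hS₂
  have hsep : w₂ 0 ∉ compAt X (gnbhd X (Set.range τ) σ)ᶜ (w₁ 0) := fun h => hne <| by
    rw [hU₁.eq_compAt (hw₁ ⟨0, rfl⟩), hU₂.eq_compAt (hw₂ ⟨0, rfl⟩)]
    exact (compAt_eq_of_mem (WalkIn.mono hSρ h)).symm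
  have hjoin : WalkIn X (gnbhd X (Set.range τ') σ)ᶜ (w₁ 0) (w₂ 0) := by
    refine ⟨P, fun v hv ⟨a, ha, hd⟩ => ?_⟩
    have haK : a ∈ K := by
      rw [hK]
      refine ⟨v, (hP v).1 hv, ?_⟩
      rw [SimpleGraph.dist_comm]
      linarith
    rw [hτ'] at ha
    rcases ha with (⟨r, hr, rfl⟩ | ha) | ⟨r, hr, rfl⟩
    · exact ham r (le_trans hr ht) haK
    · exact (hqK ▸ ⟨ha, haK⟩ : a ∈ (∅ : Set V))
    · exact hap r (le_trans hs hr) haK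
  obtain ⟨x, hxw, hxne⟩ :=
    (hubq τ' hτ'qg).exists_other (compAt X (gnbhd X (Set.range τ') σ)ᶜ (w₁ 0))
  have hfin : (gnbhd X (Set.range τ) σ \ gnbhd X (Set.range τ') σ).Finite := by
    refine (finite_gnbhd hconn hlf ((Set.finite_Icc t s).image ρ) σ).subset ?_
    rintro v ⟨⟨a, ha, hd⟩, hv⟩
    have ha' : a ∉ Set.range τ' := fun h => hv ⟨a, h, hd⟩
    rw [hτ'] at ha'
    rw [hτ] at ha
    rcases ha with ⟨r, rfl⟩ | ha
    · refine ⟨ρ r, ⟨r, ⟨?_, ?_⟩, rfl⟩, hd⟩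
      · exact le_of_not_ge fun h => ha' (Or.inl (Or.inl ⟨r, h, rfl⟩))
      · exact le_of_not_ge fun h => ha' (Or.inr ⟨r, h, rfl⟩)
    · exact absurd (Or.inl (Or.inr ha)) ha'
  obtain ⟨M, hM⟩ := compAt_subset_gnbhd_of_pieces hlf hfin (x := x) fun g hg hgR => by
    by_contra hgM
    have hgw : Wide X (compAt X (gnbhd X (Set.range τ) σ)ᶜ g) :=
      fun h => hgM (h.subset_gnbhd hconn htrans hV)
    refine hxne ?_
    rw [← compAt_eq_of_mem hg]
    rcases (hubq τ hτqg).eq_or_eq (hS₁ ⟨0, rfl⟩) (hS₂ ⟨0, rfl⟩) hgR hB₁ hB₂ hgw hsep with h | h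
    · exact compAt_eq_of_mem (WalkIn.mono hSS h)
    · exact compAt_eq_of_mem (hjoin.trans (WalkIn.mono hSS h))
  exact hxw ((hτqg.narrow_gnbhd hconn M).mono hM)
end

section
/- Assume the conventions: X is an infinite, connected, locally finite, vertex-transitive simple graph satisfying (UBQ) with separation constant σ > 0, and suppose X does not have quadratic growth. Then for every λ ≥ 1 and c ≥ 0, the collection of vertex sets of all (λ,c)-quasi-circles in X has limited jurisdiction: for every δ ≥ 0 there exists C ≥ 0 such that for every (λ,c)-quasi-circle C' in X and every finite connected component A of V ∖ N_δ(C'(∗)), we have depth(A) < C. -/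
open SimpleGraph

/-- Infinite, connected, vertex-transitive graph with finite balls. -/
structure NiceGraph {V : Type*} (X : SimpleGraph V) : Prop where
  conn : X.Connected
  finite_ball : ∀ (v : V) (r : ℕ), {u | X.dist v u ≤ r}.Finite
  trans : ∀ u v : V, ∃ φ : X ≃g X, φ u = v
  inf : Infinite V

theorem exists_adj_dist_lt {V : Type*} {X : SimpleGraph V} (hc : X.Connected) {x y : V}
    (hne : x ≠ y) : ∃ z, X.Adj x z ∧ X.dist z y + 1 = X.dist x y := by
  obtain ⟨p, hp⟩ := hc.exists_walk_length_eq_dist x y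
  cases p with
  | nil => exact absurd rfl hne
  | @cons _ z _ h q =>
    refine ⟨z, h, ?_⟩
    have h1 := X.dist_le q
    have h2 := hc.dist_triangle (u := x) (v := z) (w := y)
    have h3 := (dist_eq_one_iff_adj (G := X)).2 h
    simp only [Walk.length_cons] at hp
    omega

theorem adj_dist_le {V : Type*} {X : SimpleGraph V} (hc : X.Connected) {x y : V}
    (h : X.Adj x y) (z : V) : X.dist x z ≤ X.dist y z + 1 := by
  have h2 := hc.dist_triangle (u := x) (v := y) (w := z)
  have h3 := (dist_eq_one_iff_adj (G := X)).2 h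
  omega

theorem crossing {V : Type*} {X : SimpleGraph V} (hc : X.Connected) (W : Set V) :
    ∀ (d : ℕ) (x y : V), X.dist x y = d → x ∈ W → y ∉ W →
      ∃ u u', u ∈ W ∧ u' ∉ W ∧ X.Adj u u' ∧ X.dist x u + 1 + X.dist u' y ≤ X.dist x y := by
  intro d
  induction d with
  | zero =>
    intro x y hd hx hy
    have := hc.dist_eq_zero_iff.1 hd
    exact absurd (this ▸ hx) hy
  | succ d ih =>
    intro x y hd hx hy
    have hne : x ≠ y := fun h => hy (h ▸ hx)
    obtain ⟨z, hz, hzd⟩ := exists_adj_dist_lt hc hne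
    by_cases hzW : z ∈ W
    · obtain ⟨u, u', hu, hu', ha, hle⟩ := ih z y (by omega) hzW hy
      refine ⟨u, u', hu, hu', ha, ?_⟩
      have := adj_dist_le hc hz u
      omega
    · refine ⟨x, z, hx, hzW, hz, ?_⟩
      rw [X.dist_self]
      omega

theorem exists_dist_add {V : Type*} {X : SimpleGraph V} (hc : X.Connected) {y : V} :
    ∀ (k : ℕ) (x : V), k ≤ X.dist x y → ∃ z, X.dist x z = k ∧ X.dist z y + k = X.dist x y := by
  intro k
  induction k with
  | zero => intro x _; exact ⟨x, by simp, by simp⟩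
  | succ k ih =>
    intro x hk
    obtain ⟨z, hz, hzd⟩ := exists_adj_dist_lt (X := X) hc (x := x) (y := y) (by
      rintro rfl; simp at hk)
    obtain ⟨w, hw, hwd⟩ := ih z (by omega)
    have := adj_dist_le hc hz w
    have := hc.dist_triangle (u := x) (v := w) (w := y)
    exact ⟨w, by omega, by omega⟩

theorem iso_dist {V : Type*} {X : SimpleGraph V} (hc : X.Connected) (φ : X ≃g X) (x y : V) :
    X.dist (φ x) (φ y) = X.dist x y := by
  have key : ∀ (ψ : X ≃g X) (x y : V), X.dist (ψ x) (ψ y) ≤ X.dist x y := by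
    intro ψ x y
    obtain ⟨p, hp⟩ := hc.exists_walk_length_eq_dist x y
    have := X.dist_le (p.map ψ.toHom)
    rw [Walk.length_map, hp] at this
    exact this
  apply le_antisymm (key φ x y)
  have := key φ.symm (φ x) (φ y)
  simpa using this

/-- The ball of radius `r` as a finset (empty when infinite). -/
noncomputable def fball {V : Type*} (X : SimpleGraph V) (v : V) (r : ℕ) : Finset V :=
  open Classical in
  if h : {u | X.dist v u ≤ r}.Finite then h.toFinset else ∅

namespace NiceGraph

variable {V : Type*} {X : SimpleGraph V}

theorem mem_fball (hX : NiceGraph X) {v u : V} {r : ℕ} : u ∈ fball X v r ↔ X.dist v u ≤ r := by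
  simp [fball, hX.finite_ball v r]

theorem tri (hX : NiceGraph X) (x y z : V) : X.dist x z ≤ X.dist x y + X.dist y z :=
  hX.conn.dist_triangle

theorem fball_map (hX : NiceGraph X) (φ : X ≃g X) (v : V) (r : ℕ) :
    (fball X v r).map φ.toEquiv.toEmbedding = fball X (φ v) r := by
  ext u
  simp only [Finset.mem_map, hX.mem_fball]
  constructor
  · rintro ⟨a, ha, rfl⟩
    exact (iso_dist hX.conn φ v a).trans_le ha
  · intro h
    refine ⟨φ.symm u, ?_, by simp⟩
    rw [← iso_dist hX.conn φ]
    simpa using h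

theorem card_fball (hX : NiceGraph X) (u v : V) (r : ℕ) :
    (fball X u r).card = (fball X v r).card := by
  obtain ⟨φ, rfl⟩ := hX.trans u v
  rw [← hX.fball_map φ, Finset.card_map]

theorem fball_mono (hX : NiceGraph X) (v : V) {r s : ℕ} (h : r ≤ s) :
    fball X v r ⊆ fball X v s := fun u hu => by
  rw [hX.mem_fball] at *; omega

end NiceGraph

/-- The common cardinality of balls of radius `r`. -/
noncomputable def vol {V : Type*} (X : SimpleGraph V) (r : ℕ) : ℕ :=
  sSup (Set.range fun v => (fball X v r).card)

namespace NiceGraph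

variable {V : Type*} {X : SimpleGraph V}

theorem card_eq_vol (hX : NiceGraph X) (v : V) (r : ℕ) : (fball X v r).card = vol X r := by
  have : (fun u => (fball X u r).card) = fun _ => (fball X v r).card :=
    funext fun u => hX.card_fball u v r
  have := hX.inf
  rw [vol, ‹(fun u => (fball X u r).card) = _›, Set.range_const, csSup_singleton]

theorem vol_mono (hX : NiceGraph X) {r s : ℕ} (h : r ≤ s) : vol X r ≤ vol X s := by
  have := hX.inf
  obtain ⟨v⟩ : Nonempty V := inferInstance
  rw [← hX.card_eq_vol v, ← hX.card_eq_vol v]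
  exact Finset.card_le_card (hX.fball_mono v h)

/-- There are vertices at arbitrarily large distance. -/
theorem exists_far (hX : NiceGraph X) (v : V) (r : ℕ) : ∃ u, r < X.dist v u := by
  by_contra! h
  have := hX.inf
  exact Set.infinite_univ ((hX.finite_ball v r).subset fun u _ => h u)

theorem exists_dist_eq (hX : NiceGraph X) (v : V) (r : ℕ) : ∃ u, X.dist v u = r := by
  obtain ⟨u, hu⟩ := hX.exists_far v r
  obtain ⟨z, hz, _⟩ := exists_dist_add hX.conn r v hu.le
  exact ⟨z, hz⟩

theorem lt_vol (hX : NiceGraph X) (r : ℕ) : r < vol X r := by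
  classical
  have := hX.inf
  obtain ⟨v⟩ : Nonempty V := inferInstance
  choose f hf using hX.exists_dist_eq v
  rw [← hX.card_eq_vol v]
  have : ((Finset.range (r + 1)).image f).card = r + 1 := by
    rw [Finset.card_image_of_injective, Finset.card_range]
    intro a b h
    rw [← hf a, ← hf b, h]
  have h2 : (Finset.range (r + 1)).image f ⊆ fball X v r := by
    intro u hu
    simp only [Finset.mem_image, Finset.mem_range] at hu
    obtain ⟨a, ha, rfl⟩ := hu
    rw [hX.mem_fball, hf]; omega
  have := Finset.card_le_card h2
  omega

theorem vol_add (hX : NiceGraph X) (r s : ℕ) : vol X (r + s) ≤ vol X r * vol X s := by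
  classical
  have := hX.inf
  obtain ⟨v⟩ : Nonempty V := inferInstance
  rw [← hX.card_eq_vol v (r + s)]
  have h : fball X v (r + s) ⊆ (fball X v r).biUnion fun u => fball X u s := by
    intro y hy
    rw [hX.mem_fball] at hy
    simp only [Finset.mem_biUnion, hX.mem_fball]
    by_cases hr : r ≤ X.dist v y
    · obtain ⟨z, hz, hz'⟩ := exists_dist_add hX.conn r v hr
      exact ⟨z, hz.le, by omega⟩
    · exact ⟨y, by omega, by simp⟩
  refine (Finset.card_le_card h).trans ?_
  refine (Finset.card_biUnion_le_card_mul _ _ (vol X s) fun u _ => (hX.card_eq_vol u s).le).trans ?_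
  rw [hX.card_eq_vol]

theorem vol_zero (hX : NiceGraph X) : vol X 0 = 1 := by
  have := hX.inf
  obtain ⟨v⟩ : Nonempty V := inferInstance
  rw [← hX.card_eq_vol v, Finset.card_eq_one]
  refine ⟨v, ?_⟩
  ext u
  rw [hX.mem_fball, Finset.mem_singleton, Nat.le_zero, hX.conn.dist_eq_zero_iff]
  exact eq_comm

theorem vol_le_pow (hX : NiceGraph X) (r : ℕ) : vol X r ≤ vol X 1 ^ r := by
  induction r with
  | zero => simp [hX.vol_zero]
  | succ r ih =>
    rw [pow_succ]
    exact (hX.vol_add r 1).trans (Nat.mul_le_mul_right _ ih)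

end NiceGraph

theorem niceGraph_of {V : Type*} {X : SimpleGraph V}
    (hinf : Infinite V) (hconn : X.Connected)
    (hlf : ∀ v : V, (X.neighborSet v).Finite)
    (htrans : ∀ u v : V, ∃ φ : X ≃g X, φ u = v) : NiceGraph X := by
  refine ⟨hconn, ?_, htrans, hinf⟩
  intro v r
  induction r with
  | zero =>
    refine (Set.finite_singleton v).subset ?_
    intro u hu
    simp only [Set.mem_ofPred_eq, Nat.le_zero, hconn.dist_eq_zero_iff] at hu
    simp [hu]
  | succ r ih =>
    refine (ih.union (ih.biUnion fun u _ => hlf u)).subset ?_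
    intro u hu
    simp only [Set.mem_ofPred_eq] at hu
    simp only [Set.mem_union, Set.mem_iUnion, Set.mem_ofPred_eq, mem_neighborSet]
    by_cases h : X.dist v u ≤ r
    · exact Or.inl h
    · right
      obtain ⟨z, hz, hz'⟩ := exists_dist_add hconn r v (y := u) (by omega)
      refine ⟨z, hz.le, ?_⟩
      rw [← dist_eq_one_iff_adj]
      omega

section Components

variable {V : Type*} {X : SimpleGraph V} {U U' S : Set V}

theorem IsCompOf.mem_of_adj (hU : IsCompOf X U S) {u u' : V} (hu : u ∈ U) (h : X.Adj u u')
    (hu' : u' ∈ S) : u' ∈ U := by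
  obtain ⟨h1, h2, h3, h4⟩ := hU
  have hc : (X.induce (U ∪ {u, u'})).Connected :=
    induce_union_connected h3.preconnected (induce_pair_connected_of_adj h).preconnected
      ⟨u, hu, by simp⟩
  have := h4 (U ∪ {u, u'}) Set.subset_union_left (Set.union_subset h1 (by
    rintro x (rfl | rfl)
    · exact h1 hu
    · exact hu')) hc
  rw [← this]
  right; simp

theorem IsCompOf.eq_of_inter (hU : IsCompOf X U S) (hU' : IsCompOf X U' S)
    (h : (U ∩ U').Nonempty) : U = U' := by
  have hc : (X.induce (U ∪ U')).Connected :=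
    induce_union_connected hU.2.2.1.preconnected hU'.2.2.1.preconnected h
  have hs : U ∪ U' ⊆ S := Set.union_subset hU.1 hU'.1
  rw [← hU.2.2.2 _ Set.subset_union_left hs hc, hU'.2.2.2 _ Set.subset_union_right hs hc]

/-- A ball contained in `S` and centred in a component of `S` lies in that component. -/
theorem IsCompOf.ball_subset (hX : NiceGraph X) (hU : IsCompOf X U S) {v : V} (hv : v ∈ U) {r : ℕ}
    (h : ∀ u, X.dist v u ≤ r → u ∈ S) {u : V} (hu : X.dist v u ≤ r) : u ∈ U := by
  by_contra hn
  obtain ⟨a, b, ha, hb, hab, hle⟩ := crossing hX.conn U _ v u rfl hv hn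
  have h1 := adj_dist_le hX.conn hab.symm v
  rw [X.dist_comm, X.dist_comm (u := a)] at h1
  exact hb (hU.mem_of_adj ha hab (h b (by omega)))

end Components

/-- Bi-infinite geodesic. -/
def IsLine {V : Type*} (X : SimpleGraph V) (α : ℤ → V) : Prop :=
  ∀ s t : ℤ, X.dist (α s) (α t) = (s - t).natAbs

namespace NiceGraph

variable {V : Type*} {X : SimpleGraph V}

theorem exists_geodesic (hX : NiceGraph X) (v : V) (n : ℕ) :
    ∃ α : ℤ → V, α 0 = v ∧
      ∀ s t : ℤ, s.natAbs ≤ n → t.natAbs ≤ n → X.dist (α s) (α t) = (s - t).natAbs := by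
  obtain ⟨u, hu⟩ := hX.exists_dist_eq v (2 * n)
  obtain ⟨p, hp⟩ := hX.conn.exists_walk_length_eq_dist v u
  have key : ∀ i j : ℕ, i ≤ j → j ≤ 2 * n → X.dist (p.getVert i) (p.getVert j) = j - i := by
    have step : ∀ i j : ℕ, i ≤ j → X.dist (p.getVert i) (p.getVert j) ≤ j - i := by
      intro i j hij
      induction j, hij using Nat.le_induction with
      | base => simp
      | succ j hij ih =>
        have h1 := hX.tri (p.getVert i) (p.getVert j) (p.getVert (j + 1))
        by_cases hj : j < p.length
        · have h2 := (dist_eq_one_iff_adj (G := X)).2 (p.adj_getVert_succ hj)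
          omega
        · have h2 : p.getVert (j + 1) = p.getVert j := by
            rw [p.getVert_of_length_le (not_lt.1 hj), p.getVert_of_length_le (by omega)]
          rw [h2]
          omega
    intro i j hij hj
    have h1 := step 0 i (by omega)
    have h2 := step i j hij
    have h3 := step j (2 * n) (by omega)
    have h4 := hX.tri (p.getVert 0) (p.getVert i) (p.getVert (2 * n))
    have h5 := hX.tri (p.getVert i) (p.getVert j) (p.getVert (2 * n))
    have h6 : p.getVert (2 * n) = u := p.getVert_of_length_le (by omega)
    rw [h6] at h3 h4 h5
    rw [p.getVert_zero] at h1 h4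
    omega
  obtain ⟨φ, hφ⟩ := hX.trans (p.getVert n) v
  refine ⟨fun t => φ (p.getVert (t + n).toNat), by simpa using hφ, ?_⟩
  intro s t hs ht
  dsimp only
  rw [iso_dist hX.conn]
  rcases le_total s t with h | h
  · rw [key _ _ (by omega) (by omega)]; omega
  · rw [X.dist_comm, key _ _ (by omega) (by omega)]; omega

theorem exists_line (hX : NiceGraph X) (v : V) : ∃ α : ℤ → V, α 0 = v ∧ IsLine X α := by
  choose α h0 hα using hX.exists_geodesic v
  let F : Filter ℕ := Filter.hyperfilter ℕ
  have hF : ∀ n : ℕ, ∀ᶠ k in F, n ≤ k := fun n =>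
    (Nat.hyperfilter_le_atTop) (Filter.eventually_ge_atTop n)
  have hex : ∀ t : ℤ, ∃ x, ∀ᶠ k in F, α k t = x := by
    intro t
    have h1 : ∀ᶠ k in F, ∃ x ∈ {u | X.dist v u ≤ t.natAbs}, α k t = x := by
      filter_upwards [hF t.natAbs] with k hk
      refine ⟨α k t, ?_, rfl⟩
      have := hα k 0 t (by simp) hk
      rw [h0] at this
      simp [this]
    rw [Ultrafilter.eventually_exists_mem_iff (hX.finite_ball v _)] at h1
    obtain ⟨x, -, hx⟩ := h1
    exact ⟨x, hx⟩
  choose β hβ using hex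
  refine ⟨β, ?_, ?_⟩
  · obtain ⟨k, hk⟩ := (hβ 0).exists
    rw [← hk, h0]
  · intro s t
    obtain ⟨k, ⟨⟨h1, h2⟩, h3⟩, h4⟩ :=
      (((hβ s).and (hβ t)).and (hF s.natAbs)).and (hF t.natAbs) |>.exists
    rw [← h1, ← h2]
    exact hα k s t h3 h4

end NiceGraph

/-- Distance from `x` to the range of `c`. -/
noncomputable def idist {V ι : Type*} (X : SimpleGraph V) (c : ι → V) (x : V) : ℕ :=
  ⨅ i, X.dist x (c i)

section Idist

variable {V ι : Type*} {X : SimpleGraph V}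

theorem exists_dist_eq_idist [Nonempty ι] (X : SimpleGraph V) (c : ι → V) (x : V) :
    ∃ i, X.dist x (c i) = idist X c x :=
  ciInf_mem fun i => X.dist x (c i)

theorem idist_le (X : SimpleGraph V) (c : ι → V) (x : V) (i : ι) : idist X c x ≤ X.dist x (c i) :=
  ciInf_le (OrderBot.bddBelow _) i

theorem idist_le_add [Nonempty ι] (hc : X.Connected) (c : ι → V) (x y : V) :
    idist X c x ≤ X.dist x y + idist X c y := by
  obtain ⟨i, hi⟩ := exists_dist_eq_idist X c y
  have h1 := idist_le X c x i
  have h2 := hc.dist_triangle (u := x) (v := y) (w := c i)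
  omega

theorem mem_gnbhd_range [Nonempty ι] (c : ι → V) (x : V) {r : ℝ} (hr : 0 ≤ r) :
    x ∈ gnbhd X (Set.range c) r ↔ idist X c x ≤ ⌊r⌋₊ := by
  constructor
  · rintro ⟨_, ⟨i, rfl⟩, h⟩
    exact (idist_le X c x i).trans (Nat.le_floor h)
  · intro h
    obtain ⟨i, hi⟩ := exists_dist_eq_idist X c x
    refine ⟨c i, ⟨i, rfl⟩, ?_⟩
    rw [hi]
    exact (Nat.le_floor_iff hr).1 h

end Idist

/-- Vertices of `W` adjacent to the complement of `W` are within `s` of the path `α`. -/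
def BdryNear {V : Type*} (X : SimpleGraph V) (α : ℤ → V) (s : ℕ) (W : Set V) : Prop :=
  ∀ u u', u ∈ W → u' ∉ W → X.Adj u u' → idist X α u ≤ s

namespace BdryNear

variable {V : Type*} {X : SimpleGraph V} {α : ℤ → V} {s : ℕ} {W : Set V}

theorem ball_subset (hc : X.Connected) (hW : BdryNear X α s W) {x : V} (hx : x ∈ W) {m : ℕ}
    (h : m + s < idist X α x) {u : V} (hu : X.dist x u ≤ m) : u ∈ W := by
  by_contra hn
  obtain ⟨a, b, ha, hb, hab, hle⟩ := crossing hc W _ x u rfl hx hn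
  have h1 := hW a b ha hb hab
  have h2 := idist_le_add hc α x a
  omega

theorem exists_depth_eq (hc : X.Connected) (hW : BdryNear X α s W) {x : V} (hx : x ∈ W) {m : ℕ}
    (hm : s ≤ m) (h : m < idist X α x) : ∃ z ∈ W, idist X α z = m + 1 := by
  obtain ⟨t, ht⟩ := exists_dist_eq_idist X α x
  obtain ⟨z, hz, hz'⟩ := exists_dist_add hc (idist X α x - (m + 1)) x (y := α t) (by omega)
  refine ⟨z, ?_, ?_⟩
  · exact hW.ball_subset hc hx (m := idist X α x - (m + 1)) (by omega) hz.le
  · have h1 := idist_le X α z t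
    have h2 := idist_le_add hc α x z
    omega

end BdryNear

theorem narrow_of_idist_le {V : Type*} {X : SimpleGraph V} (hc : X.Connected) {α : ℤ → V}
    (hα : IsLine X α) {Z : Set V} {m : ℕ} (h : ∀ x ∈ Z, idist X α x ≤ m) : Narrow X Z := by
  choose t ht using fun x : V => exists_dist_eq_idist X α x
  refine ⟨1, 2 * m, fun x => t x.1, le_rfl, by positivity, ?_⟩
  rintro ⟨x, hx⟩ ⟨y, hy⟩
  have h1 := h x hx
  have h2 := h y hy
  rw [← ht] at h1 h2
  have h3 := hα (t x) (t y)
  have h4 := hc.dist_triangle (u := α (t x)) (v := x) (w := α (t y))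
  have h5 := hc.dist_triangle (u := x) (v := y) (w := α (t y))
  have h6 := hc.dist_triangle (u := x) (v := α (t x)) (w := y)
  have h7 := hc.dist_triangle (u := α (t x)) (v := α (t y)) (w := y)
  rw [X.dist_comm (u := α (t x)) (v := x)] at h4
  rw [X.dist_comm (u := α (t y)) (v := y)] at h7
  have h8 : |(t x : ℝ) - t y| = ((t x - t y).natAbs : ℝ) := by
    rw [← Int.cast_sub, ← Int.cast_abs, Int.abs_eq_natAbs, Int.cast_natCast]
  dsimp only
  rw [h8, one_mul, one_mul]
  constructor <;> norm_cast <;> omega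

theorem ubq_line {V : Type*} {X : SimpleGraph V} (hc : X.Connected) {σ : ℝ} (hσ : 0 < σ)
    (hubq : UBQ X σ) {α : ℤ → V} (hα : IsLine X α) :
    ∃ U : Set V, BdryNear X α (⌊σ⌋₊ + 1) U ∧ BdryNear X α (⌊σ⌋₊ + 1) Uᶜ ∧
      (∀ m : ℕ, ∃ x ∈ U, m < idist X α x) ∧ ∀ m : ℕ, ∃ x ∈ Uᶜ, m < idist X α x := by
  have hq : IsBiQuasiGeodesic X α := by
    refine ⟨1, 0, le_rfl, le_rfl, ?_, ?_⟩
    · intro n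
      rw [← dist_eq_one_iff_adj, hα]
      simp
    · intro s t
      rw [hα, ← Int.cast_sub, ← Int.cast_abs, Int.abs_eq_natAbs, Int.cast_natCast]
      simp
  obtain ⟨U, U', hne, hU, hU', hw, hw', -⟩ := hubq α hq
  have hdeep : ∀ Z, Wide X Z → ∀ m : ℕ, ∃ x ∈ Z, m < idist X α x := by
    intro Z hZ m
    by_contra! h
    exact hZ (narrow_of_idist_le hc hα h)
  refine ⟨U, ?_, ?_, hdeep U hw, ?_⟩
  · intro u u' hu hu' hadj
    have h1 : u' ∈ gnbhd X (Set.range α) σ := by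
      by_contra h
      exact hu' (hU.mem_of_adj hu hadj h)
    rw [mem_gnbhd_range _ _ hσ.le] at h1
    have h2 := idist_le_add hc α u u'
    rw [dist_eq_one_iff_adj.2 hadj] at h2
    omega
  · intro u u' hu hu' hadj
    have h1 : u ∈ gnbhd X (Set.range α) σ := by
      by_contra h
      exact hu (hU.mem_of_adj (Set.notMem_compl_iff.1 hu') hadj.symm h)
    rw [mem_gnbhd_range _ _ hσ.le] at h1
    omega
  · intro m
    obtain ⟨x, hx, hm⟩ := hdeep U' hw' m
    refine ⟨x, fun h => hne (hU.eq_of_inter hU' ⟨x, h, hx⟩), hm⟩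

theorem exists_adjacent_of_cover {P Q : ℤ → Prop} (h : ∀ i, P i ∨ Q i) (hP : ∃ i, P i)
    (hQ : ∃ i, Q i) : ∃ i j, P i ∧ Q j ∧ (i - j).natAbs ≤ 1 := by
  by_contra! hn
  obtain ⟨a, ha⟩ := hP
  obtain ⟨b, hb⟩ := hQ
  have hall : ∀ i, P i := by
    intro i
    induction i using Int.inductionOn' (b := a) with
    | zero => exact ha
    | succ k _ ih =>
      refine (h _).resolve_right fun hq => ?_
      have := hn _ _ ih hq
      omega
    | pred k _ ih =>
      refine (h _).resolve_right fun hq => ?_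
      have := hn _ _ ih hq
      omega
  have := hn b b (hall b) hb
  omega

namespace NiceGraph

variable {V : Type*} {X : SimpleGraph V}

theorem line_density (hX : NiceGraph X) {α : ℤ → V} (hα : IsLine X α) {s : ℕ}
    {W : Set V} (hW : BdryNear X α s W) (hdeep : ∀ m : ℕ, ∃ x ∈ W, m < idist X α x)
    {m : ℕ} (hm : s ≤ m) (i : ℤ) : ∃ x, X.dist (α i) x ≤ 5 * m + 1 ∧ m < idist X α x := by
  by_contra! hcon
  have hline : ∀ v, ∃ β : ℤ → V, β 0 = v ∧ IsLine X β ∧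
      ∀ x, X.dist v x ≤ 5 * m + 1 → ∃ t, X.dist x (β t) ≤ m := by
    intro v
    obtain ⟨φ, hφ⟩ := hX.trans (α i) v
    refine ⟨fun t => φ (α (t + i)), by simpa using hφ, ?_, ?_⟩
    · intro s t
      dsimp only
      rw [iso_dist hX.conn, hα]
      congr 1
      ring
    · intro x hx
      have h1 : X.dist (α i) (φ.symm x) ≤ 5 * m + 1 := by
        rw [← iso_dist hX.conn φ, hφ]
        simpa using hx
      obtain ⟨t, ht⟩ := exists_dist_eq_idist X α (φ.symm x)
      refine ⟨t - i, ?_⟩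
      dsimp only
      rw [sub_add_cancel, ← iso_dist hX.conn φ.symm]
      simp only [RelIso.symm_apply_apply]
      rw [ht]
      exact hcon _ h1
  obtain ⟨x, hx, hxm⟩ := hdeep (3 * m)
  obtain ⟨z, -, hz⟩ := hW.exists_depth_eq hX.conn hx (m := 3 * m) (by omega) hxm
  obtain ⟨j, hj⟩ := exists_dist_eq_idist X α z
  obtain ⟨β, h0, hβ, hβ'⟩ := hline (α j)
  obtain ⟨t, ht⟩ := hβ' z (by rw [X.dist_comm]; omega)
  have e1 := hβ 0 t
  rw [h0] at e1
  have e2 := hX.tri z (β t) (α j)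
  rw [X.dist_comm (u := β t)] at e2
  have e3 := hX.tri (α j) z (β t)
  rw [X.dist_comm (u := α j) (v := z)] at e3
  have p1 := hα j (j + t.natAbs)
  have q1 := hα j (j - t.natAbs)
  have pq := hα (j + t.natAbs) (j - t.natAbs)
  have zp := idist_le X α z (j + t.natAbs)
  have zq := idist_le X α z (j - t.natAbs)
  generalize α (j + t.natAbs) = p at *
  generalize α (j - t.natAbs) = q at *
  obtain ⟨τ, hτ⟩ := hβ' p (by omega)
  obtain ⟨τ', hτ'⟩ := hβ' q (by omega)
  have f1 := hβ 0 τ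
  have f2 := hβ 0 τ'
  rw [h0] at f1 f2
  have f3 := hβ τ τ'
  have f4 := hβ t τ
  have f5 := hβ t τ'
  have g1 := hX.tri p (β τ) (α j)
  have g2 := hX.tri (α j) p (β τ)
  have g3 := hX.tri q (β τ') (α j)
  have g4 := hX.tri (α j) q (β τ')
  have g5 := hX.tri p (β τ) q
  have g6 := hX.tri (β τ) (β τ') q
  have g7 := hX.tri z (β t) p
  have g8 := hX.tri (β t) (β τ) p
  have g9 := hX.tri z (β t) q
  have g10 := hX.tri (β t) (β τ') q
  rw [X.dist_comm (u := p) (v := α j), X.dist_comm (u := β τ) (v := α j)] at g1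
  rw [X.dist_comm (u := q) (v := α j), X.dist_comm (u := β τ') (v := α j)] at g3
  rw [X.dist_comm (u := β τ') (v := q)] at g6 g10
  rw [X.dist_comm (u := β τ) (v := p)] at g8
  have k1 : τ.natAbs ≤ t.natAbs + m ∧ t.natAbs ≤ τ.natAbs + m := by omega
  have k2 : τ'.natAbs ≤ t.natAbs + m ∧ t.natAbs ≤ τ'.natAbs + m := by omega
  have k3 : 2 * m + 1 ≤ t.natAbs := by omega
  have k4 : 2 * t.natAbs ≤ 2 * m + (τ - τ').natAbs := by omega
  have k5 : 3 * m + 1 ≤ 2 * m + (t - τ).natAbs := by omega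
  have k6 : 3 * m + 1 ≤ 2 * m + (t - τ').natAbs := by omega
  clear * - k1 k2 k3 k4 k5 k6
  omega

open Classical in
/-- Points of `W` in a ball having a neighbour outside `W`. -/
noncomputable def _root_.bdryIn (X : SimpleGraph V) (W : Set V) (z : V) (r : ℕ) : Finset V :=
  (fball X z r).filter fun u => u ∈ W ∧ ∃ u', u' ∉ W ∧ X.Adj u u'

theorem mem_bdryIn (hX : NiceGraph X) {W : Set V} {z : V} {r : ℕ} {u : V} :
    u ∈ bdryIn X W z r ↔ X.dist z u ≤ r ∧ u ∈ W ∧ ∃ u', u' ∉ W ∧ X.Adj u u' := by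
  simp [bdryIn, hX.mem_fball]

theorem card_bdryIn_le (hX : NiceGraph X) {α : ℤ → V} (hα : IsLine X α) {s : ℕ}
    {W : Set V} (hW : BdryNear X α s W) (z : V) {r : ℕ} (hr : 1 ≤ r) :
    (bdryIn X W z r).card ≤ ((4 * s + 5) * vol X s) * r := by
  classical
  rcases (bdryIn X W z r).eq_empty_or_nonempty with h | ⟨u, hu⟩
  · simp [h]
  rw [hX.mem_bdryIn] at hu
  obtain ⟨hu1, hu2, u', hu3, hu4⟩ := hu
  obtain ⟨t, ht⟩ := exists_dist_eq_idist X α u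
  have h1 := hW u u' hu2 hu3 hu4
  have hsub : bdryIn X W z r ⊆ (Finset.Icc (t - (2 * r + 2 * s : ℕ)) (t + (2 * r + 2 * s : ℕ))).biUnion
      fun k => fball X (α k) s := by
    intro w hw
    rw [hX.mem_bdryIn] at hw
    obtain ⟨hw1, hw2, w', hw3, hw4⟩ := hw
    obtain ⟨k, hk⟩ := exists_dist_eq_idist X α w
    have h2 := hW w w' hw2 hw3 hw4
    simp only [Finset.mem_biUnion, hX.mem_fball, Finset.mem_Icc]
    have h3 := hα t k
    have h4 := hX.tri (α t) u (α k)
    have h5 := hX.tri u z (α k)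
    have h6 := hX.tri z w (α k)
    rw [X.dist_comm (u := α t) (v := u)] at h4
    rw [X.dist_comm (u := u) (v := z)] at h5
    refine ⟨k, by omega, ?_⟩
    rw [X.dist_comm]
    omega
  refine (Finset.card_le_card hsub).trans ?_
  refine (Finset.card_biUnion_le_card_mul _ _ (vol X s) fun k _ => (hX.card_eq_vol _ s).le).trans ?_
  rw [Int.card_Icc, mul_right_comm]
  refine Nat.mul_le_mul_right _ ?_
  have : s ≤ s * r := Nat.le_mul_of_pos_right _ hr
  have e : (4 * s + 5) * r = 4 * (s * r) + 5 * r := by ring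
  rw [e]
  omega

/-- At every scale there are two nearby balls separated by a set with linearly growing boundary. -/
theorem exists_bisection (hX : NiceGraph X) {σ : ℝ} (hσ : 0 < σ) (hubq : UBQ X σ) :
    ∃ T K : ℕ, ∀ m : ℕ, 1 ≤ m → ∃ (U : Set V) (x y : V), X.dist x y ≤ T * m ∧
      (∀ u, X.dist x u ≤ m → u ∈ U) ∧ (∀ u, X.dist y u ≤ m → u ∉ U) ∧
      ∀ z r, 1 ≤ r → (bdryIn X U z r).card ≤ K * r := by
  have := hX.inf
  obtain ⟨v⟩ : Nonempty V := inferInstance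
  obtain ⟨α, -, hα⟩ := hX.exists_line v
  obtain ⟨U, hU, hU', hd, hd'⟩ := ubq_line hX.conn hσ hubq hα
  generalize ⌊σ⌋₊ + 1 = s at *
  refine ⟨11 * s + 14, (4 * s + 5) * vol X s, ?_⟩
  intro m hm
  let P : Set V → ℤ → Prop := fun W i =>
    ∃ x ∈ W, X.dist (α i) x ≤ 5 * (m + s) + 1 ∧ m + s < idist X α x
  have hex : ∀ W, BdryNear X α s W → (∀ m : ℕ, ∃ x ∈ W, m < idist X α x) → ∃ i, P W i := by
    intro W hW hdW
    obtain ⟨x, hx, hx'⟩ := hdW (m + s)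
    obtain ⟨z, hz, hz'⟩ := hW.exists_depth_eq hX.conn hx (by omega) hx'
    obtain ⟨i, hi⟩ := exists_dist_eq_idist X α z
    refine ⟨i, z, hz, ?_, by omega⟩
    rw [X.dist_comm]
    omega
  obtain ⟨i, j, ⟨x, hx, hxi, hxd⟩, ⟨y, hy, hyj, hyd⟩, hij⟩ :=
    exists_adjacent_of_cover (P := P U) (Q := P Uᶜ) (by
      intro i
      obtain ⟨x, hx, hx'⟩ := hX.line_density hα hU hd (m := m + s) (by omega) i
      by_cases h : x ∈ U
      · exact Or.inl ⟨x, h, hx, hx'⟩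
      · exact Or.inr ⟨x, h, hx, hx'⟩) (hex U hU hd) (hex Uᶜ hU' hd')
  refine ⟨U, x, y, ?_, ?_, ?_, ?_⟩
  · have h1 := hα i j
    have h2 := hX.tri x (α i) y
    have h3 := hX.tri (α i) (α j) y
    rw [X.dist_comm (u := x) (v := α i)] at h2
    have : s ≤ s * m := Nat.le_mul_of_pos_right _ hm
    have e : (11 * s + 14) * m = 11 * (s * m) + 14 * m := by ring
    rw [e]
    omega
  · intro u hu
    exact hU.ball_subset hX.conn hx hxd hu
  · intro u hu
    exact hU'.ball_subset hX.conn hy hyd hu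
  · intro z r hr
    exact hX.card_bdryIn_le hα hU z hr

end NiceGraph

section WalkCount

variable {V : Type*}

open Classical in
/-- Number of lazy walks of length `k` from `x` to `y`. -/
noncomputable def walkCount (X : SimpleGraph V) : ℕ → V → V → ℝ
  | 0, x, y => if x = y then 1 else 0
  | k + 1, x, y => ∑ z ∈ fball X x 1, walkCount X k z y

open Classical in
/-- Points of `A` having a neighbour outside `A`. -/
noncomputable def innerBdry (X : SimpleGraph V) (A : Finset V) : Finset V :=
  A.filter fun u => ∃ u', u' ∉ A ∧ X.Adj u u'

theorem mem_innerBdry {X : SimpleGraph V} {A : Finset V} {u : V} :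
    u ∈ innerBdry X A ↔ u ∈ A ∧ ∃ u', u' ∉ A ∧ X.Adj u u' := by
  simp [innerBdry]

/-- Invariance of a function of two vertices under automorphisms. -/
def AutInvariant (X : SimpleGraph V) (F : V → V → ℝ) : Prop :=
  ∀ (φ : X ≃g X) (x y : V), F (φ x) (φ y) = F x y

/-- The mass transport principle (unimodularity of the automorphism group). -/
def MassTransport (X : SimpleGraph V) : Prop :=
  ∀ F : V → V → ℝ, (∀ x y, 0 ≤ F x y) → AutInvariant X F →
    ∀ r x, ∑ y ∈ fball X x r, F x y = ∑ y ∈ fball X x r, F y x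

theorem walkCount_nonneg (X : SimpleGraph V) : ∀ (k : ℕ) (x y : V), 0 ≤ walkCount X k x y := by
  intro k
  induction k with
  | zero => intro x y; rw [walkCount]; split_ifs <;> norm_num
  | succ k ih => intro x y; rw [walkCount]; exact Finset.sum_nonneg fun z _ => ih z y

end WalkCount

namespace NiceGraph

variable {V : Type*} {X : SimpleGraph V}

theorem sum_fball_map (hX : NiceGraph X) (φ : X ≃g X) (x : V) (r : ℕ) (f : V → ℝ) :
    ∑ y ∈ fball X (φ x) r, f y = ∑ y ∈ fball X x r, f (φ y) := by
  rw [← hX.fball_map φ x r, Finset.sum_map]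
  rfl

theorem walkCount_inv (hX : NiceGraph X) (k : ℕ) : AutInvariant X (walkCount X k) := by
  intro φ
  induction k with
  | zero =>
    intro x y
    have := φ.injective.eq_iff (a := x) (b := y)
    by_cases h : x = y <;> simp_all [walkCount]
  | succ k ih => intro x y; rw [walkCount, walkCount, hX.sum_fball_map]; simp [ih]

theorem walkCount_eq_zero (hX : NiceGraph X) :
    ∀ (k : ℕ) (x y : V), k < X.dist x y → walkCount X k x y = 0 := by
  intro k
  induction k with
  | zero =>
    intro x y h
    rw [walkCount, if_neg]
    rintro rfl
    simp at h
  | succ k ih =>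
    intro x y h
    rw [walkCount]
    refine Finset.sum_eq_zero fun z hz => ih z y ?_
    rw [hX.mem_fball] at hz
    have := hX.tri x z y
    omega

theorem walkCount_pos (hX : NiceGraph X) :
    ∀ (k : ℕ) (x y : V), X.dist x y ≤ k → 0 < walkCount X k x y := by
  intro k
  induction k with
  | zero =>
    intro x y h
    have := hX.conn.dist_eq_zero_iff.1 (Nat.le_zero.1 h)
    simp [walkCount, this]
  | succ k ih =>
    intro x y h
    rw [walkCount]
    have hz : ∃ z ∈ fball X x 1, X.dist z y ≤ k := by
      by_cases hxy : x = y
      · exact ⟨x, by simp [hX.mem_fball], by simp [hxy]⟩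
      · obtain ⟨z, hz, hz'⟩ := exists_adj_dist_lt hX.conn hxy
        exact ⟨z, by rw [hX.mem_fball, dist_eq_one_iff_adj.2 hz], by omega⟩
    obtain ⟨z, hz, hzy⟩ := hz
    exact Finset.sum_pos' (fun w _ => walkCount_nonneg X k w y) ⟨z, hz, ih z y hzy⟩

theorem sum_walkCount_mul_le (X : SimpleGraph V) (S : Finset V) (j : ℕ) (y : V) :
    ∀ (i : ℕ) (x : V), ∑ a ∈ S, walkCount X i x a * walkCount X j a y ≤ walkCount X (i + j) x y := by
  classical
  intro i
  induction i with
  | zero =>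
    intro x
    simp only [walkCount, ite_mul, one_mul, zero_mul, Finset.sum_ite_eq, zero_add]
    split_ifs
    · rfl
    · exact walkCount_nonneg X j x y
  | succ i ih =>
    intro x
    rw [Nat.add_right_comm, walkCount]
    simp only [walkCount, Finset.sum_mul]
    rw [Finset.sum_comm]
    exact Finset.sum_le_sum fun z _ => ih z

/-- Decomposing a walk leaving `W` at a boundary vertex. -/
theorem walkCount_crossing (hX : NiceGraph X) {W : Set V} {Z : Finset V} {y : V} (hy : y ∉ W) :
    ∀ (d : ℕ) (x : V), x ∈ W →
      (∀ u u', u ∈ W → u' ∉ W → X.Adj u u' → X.dist x u ≤ d → u ∈ Z) →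
      walkCount X d x y ≤
        ∑ i ∈ Finset.range (d + 1), ∑ a ∈ Z, walkCount X i x a * walkCount X (d - i) a y := by
  classical
  intro d
  induction d with
  | zero =>
    intro x hx _
    have : x ≠ y := fun h => hy (h ▸ hx)
    rw [walkCount, if_neg this]
    exact Finset.sum_nonneg fun i _ => Finset.sum_nonneg fun a _ =>
      mul_nonneg (walkCount_nonneg _ _ _ _) (walkCount_nonneg _ _ _ _)
  | succ d ih =>
    intro x hx hZ
    rw [Finset.sum_range_succ']
    by_cases hb : ∃ u', u' ∉ W ∧ X.Adj x u'
    · obtain ⟨u', hu', hadj⟩ := hb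
      have hxZ : x ∈ Z := hZ x u' hx hu' hadj (by simp)
      refine le_add_of_nonneg_of_le (Finset.sum_nonneg fun i _ => Finset.sum_nonneg fun a _ =>
        mul_nonneg (walkCount_nonneg _ _ _ _) (walkCount_nonneg _ _ _ _)) ?_
      have : walkCount X (d + 1) x y = walkCount X 0 x x * walkCount X (d + 1 - 0) x y := by
        simp [walkCount]
      rw [this]
      exact Finset.single_le_sum (f := fun a => walkCount X 0 x a * walkCount X (d + 1 - 0) a y)
        (fun a _ => mul_nonneg (walkCount_nonneg _ _ _ _) (walkCount_nonneg _ _ _ _)) hxZ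
    · push Not at hb
      refine le_add_of_le_of_nonneg ?_ (Finset.sum_nonneg fun a _ =>
        mul_nonneg (walkCount_nonneg _ _ _ _) (walkCount_nonneg _ _ _ _))
      have h1 : walkCount X (d + 1) x y ≤ ∑ z ∈ fball X x 1, ∑ i ∈ Finset.range (d + 1),
          ∑ a ∈ Z, walkCount X i z a * walkCount X (d - i) a y := by
        rw [walkCount]
        refine Finset.sum_le_sum fun z hz => ih z ?_ ?_
        · rw [hX.mem_fball] at hz
          by_contra hzW
          rcases Nat.lt_or_ge (X.dist x z) 1 with h | h
          · have := hX.conn.dist_eq_zero_iff.1 (Nat.lt_one_iff.1 h)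
            exact hzW (this ▸ hx)
          · exact hb z hzW (dist_eq_one_iff_adj.1 (by omega))
        · intro u u' hu hu' hadj hd
          refine hZ u u' hu hu' hadj ?_
          rw [hX.mem_fball] at hz
          have := hX.tri x z u
          omega
      refine h1.trans (le_of_eq ?_)
      rw [Finset.sum_comm]
      refine Finset.sum_congr rfl fun i _ => ?_
      rw [Finset.sum_comm]
      refine Finset.sum_congr rfl fun a _ => ?_
      rw [walkCount, Finset.sum_mul, Nat.add_sub_add_right]

/-- Under mass transport, few vertices cannot separate many pairs of nearby vertices. -/
theorem MassTransport.card_pairs_le (hX : NiceGraph X) (hU : MassTransport X) {W : Set V}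
    {Z S : Finset V} {t : V → Finset V} {l : ℕ} (hS : ∀ x ∈ S, x ∈ W)
    (ht : ∀ x ∈ S, ∀ y ∈ t x, y ∉ W ∧ X.dist x y ≤ l)
    (hZ : ∀ x ∈ S, ∀ u u', u ∈ W → u' ∉ W → X.Adj u u' → X.dist x u ≤ l → u ∈ Z) :
    ∑ x ∈ S, (t x).card ≤ (l + 1) * Z.card * vol X l := by
  classical
  let g : ℕ → V → V → V → ℝ := fun i x a y =>
    walkCount X i x a * walkCount X (l - i) a y / walkCount X l x y
  have hg : ∀ i x a y, 0 ≤ g i x a y := fun i x a y =>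
    div_nonneg (mul_nonneg (walkCount_nonneg _ _ _ _) (walkCount_nonneg _ _ _ _))
      (walkCount_nonneg _ _ _ _)
  let F : ℕ → V → V → ℝ := fun i x a => ∑ y ∈ fball X x l, g i x a y
  have hF : ∀ i x a, 0 ≤ F i x a := fun i x a => Finset.sum_nonneg fun y _ => hg i x a y
  have hFinv : ∀ i, AutInvariant X (F i) := by
    intro i φ x a
    simp only [F, g]
    rw [hX.sum_fball_map]
    simp only [hX.walkCount_inv _ φ]
  have hF1 : ∀ i ≤ l, ∀ a, ∑ x ∈ fball X a l, F i a x ≤ vol X l := by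
    intro i hi a
    simp only [F]
    rw [Finset.sum_comm, ← hX.card_eq_vol a l, Finset.card_eq_sum_ones, Nat.cast_sum]
    refine Finset.sum_le_sum fun y hy => ?_
    simp only [g]
    rw [← Finset.sum_div, Nat.cast_one]
    refine div_le_one_of_le₀ ?_ (walkCount_nonneg _ _ _ _)
    have := sum_walkCount_mul_le X (fball X a l) (l - i) y i a
    rwa [Nat.add_sub_cancel' hi] at this
  have hpair : ∀ x ∈ S, ∀ y ∈ t x,
      (1 : ℝ) ≤ ∑ i ∈ Finset.range (l + 1), ∑ a ∈ Z, g i x a y := by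
    intro x hx y hy
    obtain ⟨hyW, hd⟩ := ht x hx y hy
    have h1 := hX.walkCount_crossing hyW l x (hS x hx) (hZ x hx)
    have h2 := hX.walkCount_pos l x y hd
    simp only [g]
    simp only [← Finset.sum_div]
    rwa [le_div_iff₀ h2, one_mul]
  have hia : ∀ i ≤ l, ∀ a, ∑ x ∈ S, ∑ y ∈ t x, g i x a y ≤ vol X l := by
    intro i hi a
    calc ∑ x ∈ S, ∑ y ∈ t x, g i x a y ≤ ∑ x ∈ S, F i x a := by
          refine Finset.sum_le_sum fun x hx => ?_
          exact Finset.sum_le_sum_of_subset_of_nonneg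
            (fun y hy => hX.mem_fball.2 (ht x hx y hy).2) fun y _ _ => hg i x a y
      _ = ∑ x ∈ S.filter (fun x => X.dist a x ≤ l), F i x a := by
          refine (Finset.sum_filter_of_ne ?_).symm
          intro x _ hne
          by_contra hd
          refine hne (Finset.sum_eq_zero fun y _ => ?_)
          simp only [g]
          rw [hX.walkCount_eq_zero i x a (by rw [X.dist_comm]; omega), zero_mul, zero_div]
      _ ≤ ∑ x ∈ fball X a l, F i x a :=
          Finset.sum_le_sum_of_subset_of_nonneg
            (fun y hy => hX.mem_fball.2 (Finset.mem_filter.1 hy).2) fun x _ _ => hF i x a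
      _ = ∑ x ∈ fball X a l, F i a x := (hU (F i) (hF i) (hFinv i) l a).symm
      _ ≤ vol X l := hF1 i hi a
  have hmain : ((∑ x ∈ S, (t x).card : ℕ) : ℝ) ≤ ((l + 1) * Z.card * vol X l : ℕ) := by
    calc ((∑ x ∈ S, (t x).card : ℕ) : ℝ) = ∑ x ∈ S, ∑ y ∈ t x, (1 : ℝ) := by simp
      _ ≤ ∑ x ∈ S, ∑ y ∈ t x, ∑ i ∈ Finset.range (l + 1), ∑ a ∈ Z, g i x a y :=
          Finset.sum_le_sum fun x hx => Finset.sum_le_sum fun y hy => hpair x hx y hy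
      _ = ∑ i ∈ Finset.range (l + 1), ∑ a ∈ Z, ∑ x ∈ S, ∑ y ∈ t x, g i x a y := by
          rw [Finset.sum_sigma' S t, Finset.sum_comm]
          refine Finset.sum_congr rfl fun i _ => ?_
          rw [Finset.sum_comm]
          exact Finset.sum_congr rfl fun a _ => (Finset.sum_sigma' S t fun x y => g i x a y).symm
      _ ≤ ∑ i ∈ Finset.range (l + 1), ∑ a ∈ Z, (vol X l : ℝ) := by
          refine Finset.sum_le_sum fun i hi => Finset.sum_le_sum fun a _ => hia i ?_ a
          rw [Finset.mem_range] at hi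
          omega
      _ = ((l + 1) * Z.card * vol X l : ℕ) := by
          simp [mul_assoc]
  exact_mod_cast hmain

end NiceGraph

/-- Isoperimetric inequality for sets of less than half the volume of a ball. -/
def IsopIneq {V : Type*} (X : SimpleGraph V) (K : ℕ) : Prop :=
  ∀ (A : Finset V) (l : ℕ), 2 * A.card ≤ vol X l → A.card ≤ K * (l + 1) * (innerBdry X A).card

/-- Ball volumes grow by a factor `T ^ p` when large radii are scaled by `T`. -/
def GrowthAtLeast {V : Type*} (X : SimpleGraph V) (T p : ℕ) : Prop :=
  ∃ m₀ : ℕ, ∀ m : ℕ, m₀ ≤ m → T ^ p * vol X m ≤ vol X (T * m)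

namespace NiceGraph

variable {V : Type*} {X : SimpleGraph V}

theorem vol_pos (hX : NiceGraph X) (r : ℕ) : 0 < vol X r := (Nat.zero_le r).trans_lt (hX.lt_vol r)

theorem MassTransport.isopIneq (hX : NiceGraph X) (hU : MassTransport X) : IsopIneq X 2 := by
  classical
  intro A l hl
  have h1 := MassTransport.card_pairs_le hX hU (W := A) (S := A) (Z := innerBdry X A)
    (t := fun x => fball X x l \ A) (l := l) (fun x hx => hx) (by
      intro x _ y hy
      rw [Finset.mem_sdiff, hX.mem_fball] at hy
      exact ⟨hy.2, hy.1⟩) (by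
      intro x _ u u' hu hu' hadj _
      exact mem_innerBdry.2 ⟨hu, u', hu', hadj⟩)
  have h2 : A.card * vol X l ≤ 2 * ∑ x ∈ A, (fball X x l \ A).card := by
    rw [Finset.mul_sum, ← smul_eq_mul, ← Finset.sum_const]
    refine Finset.sum_le_sum fun x _ => ?_
    have := Finset.le_card_sdiff A (fball X x l)
    rw [hX.card_eq_vol] at this
    omega
  have h3 : A.card * vol X l ≤ (2 * (l + 1) * (innerBdry X A).card) * vol X l :=
    h2.trans ((Nat.mul_le_mul_left 2 h1).trans (le_of_eq (by ring)))
  exact Nat.le_of_mul_le_mul_right h3 (hX.vol_pos l)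

/-- Failure of mass transport yields a linear isoperimetric inequality. -/
theorem linear_isop_of_not_massTransport (hX : NiceGraph X) (hN : ¬ MassTransport X) :
    ∃ K : ℕ, ∀ A : Finset V, A.card ≤ K * (innerBdry X A).card := by
  classical
  have key : ∃ (F : V → V → ℝ) (r : ℕ) (x : V), (∀ x y, 0 ≤ F x y) ∧ AutInvariant X F ∧
      ∑ y ∈ fball X x r, F y x < ∑ y ∈ fball X x r, F x y := by
    unfold MassTransport at hN
    push Not at hN
    obtain ⟨F, hF, hinv, r, x, hne⟩ := hN
    rcases lt_or_gt_of_ne hne with h | h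
    · exact ⟨fun a b => F b a, r, x, fun a b => hF b a, fun φ a b => hinv φ b a, h⟩
    · exact ⟨F, r, x, hF, hinv, h⟩
  obtain ⟨F, r, o, hF, hinv, hlt⟩ := key
  set Sp := ∑ y ∈ fball X o r, F o y with hSp
  set Sm := ∑ y ∈ fball X o r, F y o with hSm
  have hp : ∀ x, ∑ y ∈ fball X x r, F x y = Sp := by
    intro x
    obtain ⟨φ, rfl⟩ := hX.trans o x
    rw [hX.sum_fball_map]
    simp only [hinv φ]
    rfl
  have hm : ∀ x, ∑ y ∈ fball X x r, F y x = Sm := by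
    intro x
    obtain ⟨φ, rfl⟩ := hX.trans o x
    rw [hX.sum_fball_map]
    simp only [hinv φ]
    rfl
  have hSp0 : 0 ≤ Sp := Finset.sum_nonneg fun y _ => hF o y
  obtain ⟨K, hK⟩ := exists_nat_ge (vol X r * Sp / (Sp - Sm))
  have hpos : 0 < Sp - Sm := sub_pos.2 hlt
  refine ⟨K, fun A => ?_⟩
  have hZ : ∀ x ∈ A, (∃ y ∈ fball X x r, y ∉ A) → x ∈ (innerBdry X A).biUnion
      fun u => fball X u r := by
    rintro x hx ⟨y, hy, hyA⟩
    obtain ⟨u, u', hu, hu', hadj, hle⟩ := crossing hX.conn (A : Set V) _ x y rfl hx hyA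
    rw [hX.mem_fball] at hy
    simp only [Finset.mem_biUnion, hX.mem_fball, mem_innerBdry]
    refine ⟨u, ⟨hu, u', hu', hadj⟩, ?_⟩
    rw [X.dist_comm]
    omega
  have hinner : ∑ x ∈ A, ∑ y ∈ fball X x r with y ∈ A, (F x y - F y x) = 0 := by
    have e : ∀ f : V → V → ℝ, ∑ x ∈ A, ∑ y ∈ fball X x r with y ∈ A, f x y =
        ∑ x ∈ A, ∑ y ∈ A, if X.dist x y ≤ r then f x y else 0 := by
      intro f
      refine Finset.sum_congr rfl fun x _ => ?_
      rw [← Finset.sum_filter]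
      refine Finset.sum_congr ?_ fun _ _ => rfl
      ext y
      simp [hX.mem_fball, and_comm]
    have e2 : ∑ x ∈ A, ∑ y ∈ fball X x r with y ∈ A, F x y =
        ∑ x ∈ A, ∑ y ∈ fball X x r with y ∈ A, F y x := by
      rw [e, e, Finset.sum_comm]
      simp only [X.dist_comm]
    simp only [Finset.sum_sub_distrib]
    rw [e2, sub_self]
  have hmain : (A.card : ℝ) * (Sp - Sm) ≤ (innerBdry X A).card * (vol X r * Sp) := by
    calc (A.card : ℝ) * (Sp - Sm) = ∑ x ∈ A, ∑ y ∈ fball X x r, (F x y - F y x) := by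
          simp only [Finset.sum_sub_distrib, hp, hm, Finset.sum_const, nsmul_eq_mul]
          ring
      _ = ∑ x ∈ A, (∑ y ∈ fball X x r with y ∈ A, (F x y - F y x) +
            ∑ y ∈ fball X x r with y ∉ A, (F x y - F y x)) := by
          simp only [Finset.sum_filter_add_sum_filter_not]
      _ = ∑ x ∈ A, ∑ y ∈ fball X x r with y ∉ A, (F x y - F y x) := by
          rw [Finset.sum_add_distrib, hinner, zero_add]
      _ ≤ ∑ x ∈ A, if ∃ y ∈ fball X x r, y ∉ A then Sp else 0 := by
          refine Finset.sum_le_sum fun x _ => ?_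
          split_ifs with h
          · calc ∑ y ∈ fball X x r with y ∉ A, (F x y - F y x)
                ≤ ∑ y ∈ fball X x r with y ∉ A, F x y :=
                  Finset.sum_le_sum fun y _ => sub_le_self _ (hF y x)
              _ ≤ ∑ y ∈ fball X x r, F x y :=
                  Finset.sum_le_sum_of_subset_of_nonneg (Finset.filter_subset _ _)
                    fun y _ _ => hF x y
              _ = Sp := hp x
          · push Not at h
            rw [Finset.filter_false_of_mem (by simpa using h), Finset.sum_empty]
      _ = ∑ x ∈ A with ∃ y ∈ fball X x r, y ∉ A, Sp := (Finset.sum_filter _ _).symm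
      _ ≤ ∑ x ∈ (innerBdry X A).biUnion fun u => fball X u r, Sp := by
          refine Finset.sum_le_sum_of_subset_of_nonneg ?_ fun _ _ _ => hSp0
          intro x hx
          rw [Finset.mem_filter] at hx
          exact hZ x hx.1 hx.2
      _ ≤ (innerBdry X A).card * (vol X r * Sp) := by
          rw [Finset.sum_const, nsmul_eq_mul, ← mul_assoc]
          refine mul_le_mul_of_nonneg_right ?_ hSp0
          exact_mod_cast Finset.card_biUnion_le_card_mul _ _ (vol X r)
            fun u _ => (hX.card_eq_vol u r).le
  have : (A.card : ℝ) ≤ K * (innerBdry X A).card := by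
    have h1 : (A.card : ℝ) ≤ (innerBdry X A).card * (vol X r * Sp) / (Sp - Sm) :=
      (le_div_iff₀ hpos).2 hmain
    rw [mul_div_assoc, mul_comm] at h1
    exact h1.trans (mul_le_mul_of_nonneg_right hK (Nat.cast_nonneg _))
  exact_mod_cast this

theorem growth_of_linear_isop (hX : NiceGraph X) {K : ℕ}
    (hK : ∀ A : Finset V, A.card ≤ K * (innerBdry X A).card) {T : ℕ} (hT : 2 ≤ T) (p : ℕ) :
    GrowthAtLeast X T p := by
  classical
  have := hX.inf
  obtain ⟨v⟩ : Nonempty V := inferInstance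
  have h1 : ∀ n, vol X (n + 1) ≤ K * (vol X (n + 1) - vol X n) := by
    intro n
    have h2 := hK (fball X v (n + 1))
    rw [hX.card_eq_vol] at h2
    refine h2.trans (Nat.mul_le_mul_left _ ?_)
    rw [← hX.card_eq_vol v n, ← hX.card_eq_vol v (n + 1),
      ← Finset.card_sdiff_of_subset (hX.fball_mono v (Nat.le_succ n))]
    refine Finset.card_le_card fun x hx => ?_
    rw [mem_innerBdry, hX.mem_fball] at hx
    obtain ⟨hx, y, hy, hadj⟩ := hx
    rw [Finset.mem_sdiff, hX.mem_fball, hX.mem_fball]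
    refine ⟨hx, fun h => hy ?_⟩
    rw [hX.mem_fball]
    have := adj_dist_le hX.conn hadj.symm v
    rw [X.dist_comm, X.dist_comm (u := x)] at this
    omega
  have hK0 : 0 < K := by
    rcases Nat.eq_zero_or_pos K with rfl | h
    · have := h1 0
      have := hX.vol_pos (0 + 1)
      omega
    · exact h
  have h3 : ∀ n, (1 + 1 / (K : ℝ)) * vol X n ≤ vol X (n + 1) := by
    intro n
    have hKr : (0 : ℝ) < K := by exact_mod_cast hK0
    have h4 := hX.vol_mono (Nat.le_succ n)
    have h5 : (vol X (n + 1) : ℝ) ≤ K * (vol X (n + 1) - vol X n) := by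
      have := h1 n
      rw [← Nat.cast_sub h4]
      exact_mod_cast this
    have h6 : (vol X n : ℝ) ≤ vol X (n + 1) := by exact_mod_cast h4
    rw [add_mul, one_mul, one_div, inv_mul_eq_div, ← le_sub_iff_add_le', div_le_iff₀ hKr]
    linarith
  have h4 : ∀ n k, (1 + 1 / (K : ℝ)) ^ k * vol X n ≤ vol X (n + k) := by
    intro n k
    induction k with
    | zero => simp
    | succ k ih =>
      rw [pow_succ', mul_assoc]
      exact (mul_le_mul_of_nonneg_left ih (by positivity)).trans (h3 (n + k))
  have h5 : Filter.Tendsto (fun k : ℕ => (1 + 1 / (K : ℝ)) ^ k) Filter.atTop Filter.atTop :=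
    tendsto_pow_atTop_atTop_of_one_lt (by
      have : (0 : ℝ) < K := by exact_mod_cast hK0
      have : 0 < 1 / (K : ℝ) := by positivity
      linarith)
  obtain ⟨m₀, hm₀⟩ := Filter.eventually_atTop.1 (h5.eventually_ge_atTop ((T : ℝ) ^ p))
  refine ⟨m₀, fun m hm => ?_⟩
  have h6 := (mul_le_mul_of_nonneg_right (hm₀ m hm) (Nat.cast_nonneg (vol X m))).trans (h4 m m)
  have h7 : vol X (m + m) ≤ vol X (T * m) := hX.vol_mono (by nlinarith)
  have h8 : T ^ p * vol X m ≤ vol X (m + m) := by exact_mod_cast h6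
  exact h8.trans h7

theorem quadGrowth_of_vol (hX : NiceGraph X) {L : ℕ} (hL : 0 < L)
    (h : ∀ m, 1 ≤ m → vol X m ≤ L * m ^ 2) : QuadGrowth X := by
  refine ⟨L, by exact_mod_cast hL, fun v n hn => ?_⟩
  have e : {u : V | X.dist u v ≤ n} = (fball X v n : Set V) := by
    ext u
    rw [Finset.mem_coe, hX.mem_fball, X.dist_comm]
    rfl
  rw [e, Set.ncard_coe_finset, hX.card_eq_vol]
  exact_mod_cast h n hn

theorem MassTransport.vol_sq_le (hX : NiceGraph X) (hU : MassTransport X) {T K m : ℕ}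
    (hm : 1 ≤ m) {U : Set V} {x y : V} (hxy : X.dist x y ≤ T * m)
    (hx : ∀ u, X.dist x u ≤ m → u ∈ U) (hy : ∀ u, X.dist y u ≤ m → u ∉ U)
    (hb : ∀ z r, 1 ≤ r → (bdryIn X U z r).card ≤ K * r) :
    vol X m * vol X m ≤ (K * (T + 3) ^ 2) * m ^ 2 * vol X ((T + 2) * m) := by
  have h1 := MassTransport.card_pairs_le hX hU (W := U) (S := fball X x m)
    (Z := bdryIn X U x ((T + 3) * m)) (t := fun _ => fball X y m) (l := (T + 2) * m)
    (fun u hu => hx u (hX.mem_fball.1 hu)) (by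
      intro a ha b hb
      rw [hX.mem_fball] at ha hb
      refine ⟨hy b hb, ?_⟩
      have t1 := hX.tri a x b
      have t2 := hX.tri x y b
      rw [X.dist_comm (u := a) (v := x)] at t1
      rw [add_mul]
      omega) (by
      intro a ha u u' hu hu' hadj hd
      rw [hX.mem_fball] at ha
      rw [hX.mem_bdryIn]
      refine ⟨?_, hu, u', hu', hadj⟩
      have t1 := hX.tri x a u
      rw [add_mul] at *
      omega)
  rw [Finset.sum_const, hX.card_eq_vol, hX.card_eq_vol, smul_eq_mul] at h1
  refine h1.trans (Nat.mul_le_mul_right _ ?_)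
  have h2 := hb x ((T + 3) * m) (by nlinarith)
  have h3 : (T + 2) * m + 1 ≤ (T + 3) * m := by nlinarith
  calc ((T + 2) * m + 1) * (bdryIn X U x ((T + 3) * m)).card
      ≤ ((T + 3) * m) * (K * ((T + 3) * m)) := Nat.mul_le_mul h3 h2
    _ = K * (T + 3) ^ 2 * m ^ 2 := by ring

theorem quadGrowth_of_vol_sq_le (hX : NiceGraph X) {T K p : ℕ} (hT : 2 ≤ T)
    (h : ∀ m, 1 ≤ m → vol X m * vol X m ≤ K * m ^ 2 * vol X (T * m))
    (hng : ¬ GrowthAtLeast X T p) : QuadGrowth X := by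
  classical
  unfold GrowthAtLeast at hng
  push Not at hng
  have hinf : ∀ m₀, ∃ R, m₀ ≤ R ∧ vol X R ≤ (K * T ^ p) * R ^ 2 := by
    intro m₀
    obtain ⟨R, hR, hlt⟩ := hng (m₀ + 1)
    refine ⟨R, by omega, ?_⟩
    have h1 := h R (by omega)
    have h2 : vol X R * vol X R ≤ ((K * T ^ p) * R ^ 2) * vol X R :=
      h1.trans ((Nat.mul_le_mul_left _ hlt.le).trans (le_of_eq (by ring)))
    exact Nat.le_of_mul_le_mul_right h2 (hX.vol_pos R)
  set L₀ := K * T ^ p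
  set L := K * T ^ 2 + L₀ * T ^ 2 + 1 with hL
  refine hX.quadGrowth_of_vol (L := L) (by omega) ?_
  by_contra! hbad
  obtain ⟨m, hm1, hm⟩ := hbad
  obtain ⟨R, hR, hvR⟩ := hinf m
  let P : ℕ → Prop := fun k => L * k ^ 2 < vol X k
  set M := Nat.findGreatest P R with hM
  have hMm : m ≤ M := Nat.le_findGreatest hR hm
  have hMR : M ≤ R := Nat.findGreatest_le R
  have hPM : L * M ^ 2 < vol X M := Nat.findGreatest_spec (P := P) hR hm
  have hgt : ∀ k, M < k → k ≤ R → vol X k ≤ L * k ^ 2 := fun k hk hk' =>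
    not_lt.1 (Nat.findGreatest_is_greatest (P := P) hk hk')
  rcases Nat.lt_or_ge R (T * M) with hlt | hge
  · have h1 := hX.vol_mono hMR
    have h2 : L₀ * R ^ 2 ≤ L₀ * (T * M) ^ 2 :=
      Nat.mul_le_mul_left _ (Nat.pow_le_pow_left hlt.le 2)
    have h3 : L₀ * (T * M) ^ 2 ≤ L * M ^ 2 := by
      rw [mul_pow, ← mul_assoc]
      refine Nat.mul_le_mul_right _ ?_
      omega
    omega
  · have h1 := hgt (T * M) (by nlinarith) hge
    have h2 := h M (by omega)
    have h3 : L * M ^ 2 * vol X M ≤ vol X M * vol X M := Nat.mul_le_mul_right _ hPM.le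
    have h4 : L * M ^ 2 * vol X M ≤ L * M ^ 2 * (K * T ^ 2 * M ^ 2) :=
      h3.trans (h2.trans ((Nat.mul_le_mul_left _ h1).trans (le_of_eq (by ring))))
    have h5 : vol X M ≤ K * T ^ 2 * M ^ 2 :=
      Nat.le_of_mul_le_mul_left h4 (Nat.mul_pos (by omega) (Nat.pow_pos (by omega)))
    have h6 : K * T ^ 2 * M ^ 2 ≤ L * M ^ 2 := Nat.mul_le_mul_right _ (by omega)
    omega

/-- The dichotomy: isoperimetry together with fast growth, unless growth is quadratic. -/
theorem isop_and_growth (hX : NiceGraph X) {σ : ℝ} (hσ : 0 < σ) (hubq : UBQ X σ)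
    (hng : ¬ QuadGrowth X) (p : ℕ) :
    ∃ K T : ℕ, 2 ≤ T ∧ IsopIneq X K ∧ GrowthAtLeast X T p := by
  obtain ⟨T, K, hTK⟩ := hX.exists_bisection hσ hubq
  by_cases hU : MassTransport X
  · refine ⟨2, T + 2, by omega, MassTransport.isopIneq hX hU, ?_⟩
    by_contra hG
    refine hng (hX.quadGrowth_of_vol_sq_le (T := T + 2) (K := K * (T + 3) ^ 2)
      (by omega) ?_ hG)
    intro m hm
    obtain ⟨U, x, y, hxy, hx, hy, hb⟩ := hTK m hm
    exact MassTransport.vol_sq_le hX hU hm hxy hx hy hb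
  · obtain ⟨K', hK'⟩ := hX.linear_isop_of_not_massTransport hU
    refine ⟨K', 2, le_rfl, ?_, hX.growth_of_linear_isop hK' le_rfl p⟩
    intro A l _
    refine (hK' A).trans (Nat.mul_le_mul_right _ ?_)
    exact Nat.le_mul_of_pos_right _ (by omega)

end NiceGraph

theorem two_pow_le_of_growth {a : ℕ → ℕ} (ha : Monotone a) {E k : ℕ} (hE : 0 < E) (h1 : 1 ≤ a 1)
    (h : ∀ i, 1 ≤ i → i ≤ k * E → a i + E * a i ≤ E * a (i + 1)) : 2 ^ k ≤ a (k * E + 1) := by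
  have hstep : ∀ i, 1 ≤ i → ∀ j, i + j ≤ k * E + 1 → j * a i + E * a i ≤ E * a (i + j) := by
    intro i hi j
    induction j with
    | zero => intro _; simp
    | succ j ih =>
      intro hj
      have h2 := ih (by omega)
      have h3 := h (i + j) (by omega) (by omega)
      have h4 : a i ≤ a (i + j) := ha (Nat.le_add_right _ _)
      rw [← add_assoc, add_mul, one_mul]
      omega
  have hdouble : ∀ j ≤ k, 2 ^ j ≤ a (j * E + 1) := by
    intro j
    induction j with
    | zero => intro _; simpa using h1
    | succ j ih =>
      intro hj
      have h2 := ih (by omega)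
      have h5 : (j + 1) * E ≤ k * E := Nat.mul_le_mul_right _ hj
      have e : (j + 1) * E = j * E + E := by ring
      have h3 := hstep (j * E + 1) (by omega) E (by omega)
      rw [← two_mul, mul_left_comm] at h3
      have h4 := Nat.le_of_mul_le_mul_left h3 hE
      rw [e, Nat.add_right_comm, pow_succ]
      omega
  exact hdouble k le_rfl

/-- Points of `A` within `R` of `c t` for some `|t| ≤ j`. -/
noncomputable def tubePart {V : Type*} (X : SimpleGraph V) (A : Finset V) (c : ℤ → V)
    (R j : ℕ) : Finset V :=
  open Classical in A.filter fun x => ∃ t : ℤ, t.natAbs ≤ j ∧ X.dist x (c t) ≤ R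

theorem mem_tubePart {V : Type*} {X : SimpleGraph V} {A : Finset V} {c : ℤ → V} {R j : ℕ} {x : V} :
    x ∈ tubePart X A c R j ↔ x ∈ A ∧ ∃ t : ℤ, t.natAbs ≤ j ∧ X.dist x (c t) ≤ R := by
  simp [tubePart]

/-- A finite set filling in the path `c` up to scale `R`: it lies within `R` of `c`, its boundary
lies within `D` of `c`, it contains a ball of radius `R / 2` centred within `R` of `c 0`, and `c`
leaves balls of radius `3 * R` in time `w`. -/
structure Fills {V : Type*} (X : SimpleGraph V) (A : Finset V) (c : ℤ → V) (v : V)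
    (R D w : ℕ) : Prop where
  proper : ∀ t t' : ℤ, X.dist (c t) (c t') ≤ 3 * R → ∃ t₂, c t₂ = c t' ∧ (t₂ - t).natAbs ≤ w
  near : ∀ x ∈ A, ∃ t, X.dist x (c t) ≤ R
  bdry : ∀ x ∈ innerBdry X A, ∃ t, X.dist x (c t) ≤ D
  centre : X.dist v (c 0) ≤ R
  ball : fball X v (R / 2) ⊆ A

namespace Fills

variable {V : Type*} {X : SimpleGraph V} {A : Finset V} {c : ℤ → V} {v : V} {R D w : ℕ}

theorem card_biUnion_le (hX : NiceGraph X) (c : ℤ → V) (j D : ℕ) {S : Finset V}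
    (hS : ∀ x ∈ S, ∃ t : ℤ, t.natAbs ≤ j ∧ X.dist x (c t) ≤ D) :
    S.card ≤ (2 * j + 1) * vol X D := by
  classical
  have hsub : S ⊆ (Finset.Icc (-(j : ℤ)) j).biUnion fun t => fball X (c t) D := by
    intro x hx
    obtain ⟨t, ht, hd⟩ := hS x hx
    simp only [Finset.mem_biUnion, hX.mem_fball, Finset.mem_Icc]
    exact ⟨t, by omega, by rwa [X.dist_comm]⟩
  refine (Finset.card_le_card hsub).trans ?_
  refine (Finset.card_biUnion_le_card_mul _ _ (vol X D) fun k _ => (hX.card_eq_vol _ D).le).trans ?_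
  rw [Int.card_Icc]
  exact Nat.mul_le_mul_right _ (by omega)

theorem card_innerBdry_le (hX : NiceGraph X) (hA : Fills X A c v R D w) (hD : D ≤ R) (hR : 1 ≤ R)
    (i : ℕ) :
    (innerBdry X (tubePart X A c R (i * w))).card ≤ (2 * ((i + 1) * w) + 1) * vol X D +
      vol X 1 * ((tubePart X A c R ((i + 1) * w)).card - (tubePart X A c R (i * w)).card) := by
  classical
  set B := tubePart X A c R (i * w)
  set B' := tubePart X A c R ((i + 1) * w)
  have hBB : B ⊆ B' := by
    intro x hx
    rw [mem_tubePart] at *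
    obtain ⟨hxA, t, ht, hd⟩ := hx
    exact ⟨hxA, t, ht.trans (Nat.mul_le_mul_right _ (Nat.le_succ i)), hd⟩
  have hsub : innerBdry X B ⊆ ((innerBdry X B).filter fun x =>
      ∃ t : ℤ, t.natAbs ≤ (i + 1) * w ∧ X.dist x (c t) ≤ D) ∪
      (B' \ B).biUnion fun y => fball X y 1 := by
    intro x hx
    have hx0 := hx
    rw [mem_innerBdry] at hx
    obtain ⟨hxB, y, hyB, hadj⟩ := hx
    obtain ⟨hxA, t, ht, hd⟩ := mem_tubePart.1 hxB
    rw [Finset.mem_union]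
    by_cases hyA : y ∈ A
    · right
      rw [Finset.mem_biUnion]
      refine ⟨y, ?_, ?_⟩
      · rw [Finset.mem_sdiff]
        refine ⟨?_, hyB⟩
        obtain ⟨t', ht'⟩ := hA.near y hyA
        have h1 := hX.tri (c t) x (c t')
        have h2 := hX.tri x y (c t')
        rw [X.dist_comm (u := c t) (v := x)] at h1
        rw [dist_eq_one_iff_adj.2 hadj] at h2
        obtain ⟨t₂, e, hle⟩ := hA.proper t t' (by omega)
        refine mem_tubePart.2 ⟨hyA, t₂, ?_, by rwa [e]⟩
        rw [add_mul, one_mul]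
        omega
      · rw [hX.mem_fball, dist_eq_one_iff_adj.2 hadj.symm]
    · left
      refine Finset.mem_filter.2 ⟨hx0, ?_⟩
      obtain ⟨t', ht'⟩ := hA.bdry x (mem_innerBdry.2 ⟨hxA, y, hyA, hadj⟩)
      have h1 := hX.tri (c t) x (c t')
      rw [X.dist_comm (u := c t) (v := x)] at h1
      obtain ⟨t₂, e, hle⟩ := hA.proper t t' (by omega)
      refine ⟨t₂, ?_, by rwa [e]⟩
      rw [add_mul, one_mul]
      omega
  refine (Finset.card_le_card hsub).trans ((Finset.card_union_le _ _).trans (add_le_add ?_ ?_))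
  · exact card_biUnion_le hX c _ D fun x hx => (Finset.mem_filter.1 hx).2
  · refine (Finset.card_biUnion_le_card_mul _ _ (vol X 1)
      fun k _ => (hX.card_eq_vol _ 1).le).trans ?_
    rw [Finset.card_sdiff_of_subset hBB, mul_comm]

theorem two_pow_le (hX : NiceGraph X) (hA : Fills X A c v R D w) (hD : D ≤ R) (hR : 1 ≤ R)
    {K : ℕ} (hK : 0 < K) (hisop : IsopIneq X K) {l k Q : ℕ}
    (hQ : Q = k * (2 * K * (l + 1) * vol X 1))
    (hl : 2 * ((2 * ((Q + 1) * w) + 1) * vol X R) ≤ vol X l)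
    (hv : 2 * K * (l + 1) * ((2 * ((Q + 1) * w) + 1) * vol X D) ≤ vol X (R / 2)) :
    2 ^ k ≤ (2 * ((Q + 1) * w) + 1) * vol X R := by
  classical
  set a : ℕ → ℕ := fun i => (tubePart X A c R (i * w)).card with ha
  have hmono : Monotone a := by
    intro i j hij
    refine Finset.card_le_card fun x hx => ?_
    rw [mem_tubePart] at *
    obtain ⟨hxA, t, ht, hd⟩ := hx
    exact ⟨hxA, t, ht.trans (Nat.mul_le_mul_right _ hij), hd⟩
  have hup : ∀ i ≤ Q + 1, a i ≤ (2 * ((Q + 1) * w) + 1) * vol X R := by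
    intro i hi
    refine (card_biUnion_le hX c (i * w) R fun x hx => (mem_tubePart.1 hx).2).trans ?_
    refine Nat.mul_le_mul_right _ ?_
    have := Nat.mul_le_mul_right w hi
    omega
  have hlow : vol X (R / 2) ≤ a 1 := by
    rw [← hX.card_eq_vol v]
    refine Finset.card_le_card fun x hx => ?_
    have hxA := hA.ball hx
    rw [hX.mem_fball] at hx
    obtain ⟨t', ht'⟩ := hA.near x hxA
    have h1 := hX.tri (c 0) v (c t')
    have h2 := hX.tri v x (c t')
    have h3 := hA.centre
    rw [X.dist_comm] at h3
    obtain ⟨t₂, e, hle⟩ := hA.proper 0 t' (by omega)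
    exact mem_tubePart.2 ⟨hxA, t₂, by rw [one_mul]; omega, by rwa [e]⟩
  have hE : 0 < 2 * K * (l + 1) * vol X 1 := by
    have := hX.vol_pos 1
    positivity
  refine le_trans ?_ (hup (Q + 1) le_rfl)
  rw [hQ]
  refine two_pow_le_of_growth hmono hE ((hX.vol_pos _).trans_le hlow) ?_
  intro i hi hiQ
  rw [← hQ] at hiQ
  have h1 := hisop (tubePart X A c R (i * w)) l
    ((Nat.mul_le_mul_left 2 (hup i (by omega))).trans hl)
  have h2 := hA.card_innerBdry_le hX hD hR i
  have h3 : a i ≤ K * (l + 1) * ((2 * ((i + 1) * w) + 1) * vol X D +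
      vol X 1 * (a (i + 1) - a i)) := h1.trans (Nat.mul_le_mul_left _ h2)
  have h4 : 2 * K * (l + 1) * ((2 * ((i + 1) * w) + 1) * vol X D) ≤ a i := by
    refine le_trans ?_ (hv.trans (hlow.trans (hmono hi)))
    refine Nat.mul_le_mul_left _ (Nat.mul_le_mul_right _ ?_)
    have := Nat.mul_le_mul_right w (show i + 1 ≤ Q + 1 by omega)
    omega
  obtain ⟨d, hd⟩ := Nat.exists_eq_add_of_le (hmono (Nat.le_succ i))
  rw [Nat.succ_eq_add_one] at hd
  rw [hd] at h3 ⊢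
  rw [Nat.add_sub_cancel_left] at h3
  nlinarith

end Fills

namespace GrowthAtLeast

variable {V : Type*} {X : SimpleGraph V} {T p : ℕ}

theorem pow_mul_le {m₀ : ℕ} (hT : 1 ≤ T) (h : ∀ m, m₀ ≤ m → T ^ p * vol X m ≤ vol X (T * m))
    {m : ℕ} (hm : m₀ ≤ m) (j : ℕ) : (T ^ j) ^ p * vol X m ≤ vol X (T ^ j * m) := by
  induction j with
  | zero => simp
  | succ j ih =>
    have h1 := h (T ^ j * m) (hm.trans (Nat.le_mul_of_pos_left _ (Nat.pow_pos hT)))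
    have e : T ^ (j + 1) = T * T ^ j := pow_succ' T j
    rw [e, mul_pow, mul_assoc, mul_assoc T]
    exact (Nat.mul_le_mul_left _ ih).trans h1

theorem exists_pow_between (hT : 2 ≤ T) {r : ℕ} (hr : 1 ≤ r) :
    ∃ j, r ≤ T ^ j ∧ T ^ j ≤ T * r := by
  refine ⟨Nat.clog T r, Nat.le_pow_clog hT r, ?_⟩
  rcases Nat.lt_or_ge 1 r with h | h
  · have h1 := Nat.pow_pred_clog_lt_self hT h
    have h2 := Nat.clog_pos hT h
    obtain ⟨j, hj⟩ := Nat.exists_eq_succ_of_ne_zero h2.ne'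
    rw [hj] at h1 ⊢
    rw [Nat.pow_succ']
    exact Nat.mul_le_mul_left _ h1.le
  · have : r = 1 := le_antisymm h hr
    subst this
    simp
    omega

/-- Consequences of fast growth at a single large scale. -/
theorem eventually (hX : NiceGraph X) (hT : 2 ≤ T) (hG : GrowthAtLeast X T p) :
    ∃ R₀ : ℕ, ∀ R, R₀ ≤ R → (∃ l, l ≤ T * R * R ∧ R ^ p * vol X R ≤ vol X l) ∧
      (Nat.sqrt R) ^ p ≤ vol X (R / 2) := by
  obtain ⟨m₀, hm₀⟩ := hG
  refine ⟨(2 * T * (m₀ + 1)) ^ 2 + m₀ + 1, fun R hR => ⟨?_, ?_⟩⟩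
  · obtain ⟨j, hj, hj'⟩ := exists_pow_between hT (r := R) (by omega)
    refine ⟨T ^ j * R, Nat.mul_le_mul_right _ hj', ?_⟩
    exact (Nat.mul_le_mul_right _ (Nat.pow_le_pow_left hj p)).trans
      (pow_mul_le (by omega) hm₀ (by omega) j)
  · have hs : 2 * T * (m₀ + 1) ≤ Nat.sqrt R := Nat.le_sqrt'.2 (by omega)
    have hs1 : 1 ≤ Nat.sqrt R := le_trans (by nlinarith) hs
    obtain ⟨j, hj, hj'⟩ := exists_pow_between hT hs1
    have h1 := pow_mul_le (by omega) hm₀ (Nat.le_succ m₀) j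
    have h2 : T ^ j * (m₀ + 1) ≤ R / 2 := by
      rw [Nat.le_div_iff_mul_le (by norm_num)]
      calc T ^ j * (m₀ + 1) * 2 ≤ T * Nat.sqrt R * (m₀ + 1) * 2 := by gcongr
        _ = (2 * T * (m₀ + 1)) * Nat.sqrt R := by ring
        _ ≤ Nat.sqrt R * Nat.sqrt R := Nat.mul_le_mul_right _ hs
        _ ≤ R := Nat.sqrt_le R
    calc Nat.sqrt R ^ p ≤ (T ^ j) ^ p := Nat.pow_le_pow_left hj p
      _ ≤ (T ^ j) ^ p * vol X (m₀ + 1) := Nat.le_mul_of_pos_right _ (hX.vol_pos _)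
      _ ≤ vol X (T ^ j * (m₀ + 1)) := h1
      _ ≤ vol X (R / 2) := hX.vol_mono h2

end GrowthAtLeast

theorem NiceGraph.not_fills {V : Type*} {X : SimpleGraph V} (hX : NiceGraph X) {K T : ℕ}
    (hT : 2 ≤ T) (hK : IsopIneq X K) (hG : GrowthAtLeast X T 64) (D : ℕ) :
    ∃ R₀ : ℕ, ∀ R, R₀ ≤ R → ∀ A c v, ¬ Fills X A c v R D (R ^ 2) := by
  obtain ⟨R₁, hR₁⟩ := GrowthAtLeast.eventually hX hT hG
  have hK' : IsopIneq X (K + 1) := fun A l hl =>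
    (hK A l hl).trans (Nat.mul_le_mul_right _ (Nat.mul_le_mul_right _ (Nat.le_succ K)))
  refine ⟨R₁ + T + D + 2 * (K + 1) * vol X 1 + vol X D + vol X 1 + 10, ?_⟩
  intro R hR A c v hA
  obtain ⟨⟨l, hl, hvl⟩, hsq⟩ := hR₁ R (by omega)
  have hR10 : 10 ≤ R := by omega
  have hKR : 2 * (K + 1) * vol X 1 ≤ R := by omega
  have hvD : vol X D ≤ R := by omega
  have hTR : T ≤ R := by omega
  have hKR' : 2 * (K + 1) ≤ R :=
    (Nat.le_mul_of_pos_right _ (hX.vol_pos 1)).trans hKR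
  have hl3 : l + 1 ≤ R ^ 4 := by
    have h1 : T * R * R ≤ R * R * R := by gcongr
    have h2 : R ^ 4 = R * (R * R * R) := by ring
    have h3 : 1 ≤ R * R * R := by nlinarith [Nat.mul_pos (show 0 < R by omega) (show 0 < R by omega)]
    rw [h2]
    nlinarith
  set Q := R ^ 2 * (2 * (K + 1) * (l + 1) * vol X 1) with hQ
  have hQ7 : Q ≤ R ^ 7 := by
    calc Q = R ^ 2 * ((2 * (K + 1) * vol X 1) * (l + 1)) := by rw [hQ]; ring
      _ ≤ R ^ 2 * (R * R ^ 4) := by gcongr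
      _ = R ^ 7 := by ring
  have hN : 2 * ((Q + 1) * R ^ 2) + 1 ≤ R ^ 10 := by
    have h1 : 1 ≤ R ^ 7 := Nat.one_le_pow _ _ (by omega)
    have h2 : 1 ≤ R ^ 9 := Nat.one_le_pow _ _ (by omega)
    calc 2 * ((Q + 1) * R ^ 2) + 1 ≤ 2 * ((R ^ 7 + R ^ 7) * R ^ 2) + R ^ 9 := by gcongr
      _ = 5 * R ^ 9 := by ring
      _ ≤ R * R ^ 9 := by gcongr; omega
      _ = R ^ 10 := by ring
  have hsqR : R ≤ Nat.sqrt R ^ 4 := by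
    have h1 := Nat.lt_succ_sqrt R
    have h2 : 3 ≤ Nat.sqrt R := Nat.le_sqrt'.2 (by omega)
    generalize Nat.sqrt R = s at *
    have h3 : s + 1 ≤ s * s := by nlinarith
    calc R ≤ (s + 1) * (s + 1) := h1.le
      _ ≤ (s * s) * (s * s) := Nat.mul_le_mul h3 h3
      _ = s ^ 4 := by ring
  have key := hA.two_pow_le hX (by omega) (by omega) (Nat.succ_pos K) hK' (l := l) (k := R ^ 2) hQ
    (by
      calc 2 * ((2 * ((Q + 1) * R ^ 2) + 1) * vol X R) ≤ R * (R ^ 10 * vol X R) := by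
            gcongr; omega
        _ = R ^ 11 * vol X R := by ring
        _ ≤ R ^ 64 * vol X R := by
            gcongr
            · omega
            · norm_num
        _ ≤ vol X l := hvl)
    (by
      calc 2 * (K + 1) * (l + 1) * ((2 * ((Q + 1) * R ^ 2) + 1) * vol X D)
          ≤ R * R ^ 4 * (R ^ 10 * R) := by gcongr
        _ = R ^ 16 := by ring
        _ ≤ (Nat.sqrt R ^ 4) ^ 16 := Nat.pow_le_pow_left hsqR 16
        _ = Nat.sqrt R ^ 64 := by rw [← pow_mul]
        _ ≤ vol X (R / 2) := hsq)
  have hlt : (2 * ((Q + 1) * R ^ 2) + 1) * vol X R < 2 ^ (R ^ 2) := by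
    calc (2 * ((Q + 1) * R ^ 2) + 1) * vol X R ≤ R ^ 10 * vol X 1 ^ R :=
          Nat.mul_le_mul hN (hX.vol_le_pow R)
      _ < (2 ^ R) ^ 10 * (2 ^ vol X 1) ^ R := by
          refine Nat.mul_lt_mul_of_lt_of_le (Nat.pow_lt_pow_left Nat.lt_two_pow_self (by norm_num))
            (Nat.pow_le_pow_left Nat.lt_two_pow_self.le R) (by positivity)
      _ = 2 ^ ((10 + vol X 1) * R) := by rw [← pow_mul, ← pow_mul, ← pow_add]; ring_nf
      _ ≤ 2 ^ (R ^ 2) := by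
          refine Nat.pow_le_pow_right (by norm_num) ?_
          rw [pow_two]
          exact Nat.mul_le_mul_right _ (by omega)
  omega

/-- Unrolled quasi-circles are proper: nearby points have nearby parameters. -/
theorem IsQuasiCircle.exists_param {V : Type*} {X : SimpleGraph V} {lam c : ℝ} {n : ℕ}
    {circ : ZMod n → V} (hC : IsQuasiCircle X lam c n circ) (hlam : 1 ≤ lam) (k₀ : ZMod n)
    {R w : ℕ} (hw : lam * (3 * R + c) ≤ w) (t t' : ℤ)
    (hd : X.dist (circ (k₀ + (t : ZMod n))) (circ (k₀ + (t' : ZMod n))) ≤ 3 * R) :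
    ∃ t₂ : ℤ, circ (k₀ + (t₂ : ZMod n)) = circ (k₀ + (t' : ZMod n)) ∧ (t₂ - t).natAbs ≤ w := by
  obtain ⟨hn, -, hq⟩ := hC
  have : NeZero n := ⟨by omega⟩
  set e : ℤ := ((t' - t : ℤ) : ZMod n).valMinAbs with he
  have hcast : ((e : ℤ) : ZMod n) = ((t' - t : ℤ) : ZMod n) := ZMod.coe_valMinAbs _
  have hle : e.natAbs ≤ n / 2 := ZMod.natAbs_valMinAbs_le _
  have hend : k₀ + ((t + e : ℤ) : ZMod n) = k₀ + (t' : ZMod n) := by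
    rw [Int.cast_add, hcast, Int.cast_sub]
    ring
  refine ⟨t + e, by rw [hend], ?_⟩
  rw [add_sub_cancel_left]
  have hlen : (e.natAbs : ℝ) / lam - c ≤ 3 * R := by
    have hd' : (X.dist (circ (k₀ + (t : ZMod n))) (circ (k₀ + (t' : ZMod n))) : ℝ) ≤ 3 * R := by
      exact_mod_cast hd
    refine le_trans ?_ hd'
    rcases le_total 0 e with h | h
    · have h1 := hq (k₀ + (t : ZMod n)) e.natAbs 0 e.natAbs (by omega) (Nat.zero_le _) le_rfl
      have h2 : ((e.natAbs : ℕ) : ZMod n) = (e : ZMod n) := by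
        rw [← Int.cast_natCast, Int.natAbs_of_nonneg h]
      have h3 : k₀ + (t : ZMod n) + (e : ZMod n) = k₀ + (t' : ZMod n) := by
        rw [← hend, Int.cast_add]
        ring
      rw [h2, h3] at h1
      simpa using h1
    · have h1 := hq (k₀ + (t' : ZMod n)) e.natAbs e.natAbs 0 (by omega) le_rfl (Nat.zero_le _)
      have h2 : ((e.natAbs : ℕ) : ZMod n) = -(e : ZMod n) := by
        rw [← Int.cast_natCast, Int.ofNat_natAbs_of_nonpos h, Int.cast_neg]
      have h3 : k₀ + (t' : ZMod n) + -(e : ZMod n) = k₀ + (t : ZMod n) := by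
        rw [← hend, Int.cast_add]
        ring
      rw [h2, h3] at h1
      simpa using h1
  have hlam0 : 0 < lam := by linarith
  have h1 : (e.natAbs : ℝ) ≤ lam * (3 * R + c) := by
    rw [← div_le_iff₀' hlam0]
    linarith
  exact_mod_cast h1.trans hw

theorem gdepth_le {V ι : Type*} [Nonempty ι] {X : SimpleGraph V} (hc : X.Connected) {A : Set V}
    {c : ι → V} (hA : ∀ i, c i ∉ A) {R : ℕ} (hR : ∀ x ∈ A, idist X c x ≤ R) : gdepth X A ≤ R := by
  refine csInf_le ⟨0, fun r hr => hr.1⟩ ⟨Nat.cast_nonneg R, fun x hx => ?_⟩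
  obtain ⟨i, hi⟩ := exists_dist_eq_idist X c x
  obtain ⟨u, u', hu, hu', hadj, hle⟩ := crossing hc A _ x (c i) rfl hx (hA i)
  refine ⟨u', ⟨hu', u, hu, hadj.symm⟩, ?_⟩
  have h1 := adj_dist_le hc hadj.symm x
  rw [X.dist_comm, X.dist_comm (u := u)] at h1
  have := hR x hx
  have : X.dist x u' ≤ R := by omega
  exact_mod_cast this

/-- A finite complementary component of a neighbourhood of a quasi-circle fills it at the scale
given by its farthest point. -/
theorem IsQuasiCircle.fills {V : Type*} {X : SimpleGraph V} (hX : NiceGraph X) {lam c δ : ℝ} {n : ℕ}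
    {circ : ZMod n → V} (hC : IsQuasiCircle X lam c n circ) (hlam : 1 ≤ lam) (hδ : 0 ≤ δ)
    {A : Set V} (hA : IsCompOf X A (gnbhd X (Set.range circ) δ)ᶜ) (hfin : A.Finite)
    {v : V} (hv : v ∈ A) (hmax : ∀ x ∈ A, idist X circ x ≤ idist X circ v) {w : ℕ}
    (hw : lam * (3 * (idist X circ v : ℕ) + c) ≤ w) (hR : 2 * ⌊δ⌋₊ + 2 ≤ idist X circ v) :
    ∃ c' : ℤ → V, Fills X hfin.toFinset c' v (idist X circ v) (⌊δ⌋₊ + 1) w := by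
  have hn : NeZero n := ⟨by have := hC.1; omega⟩
  obtain ⟨k₀, hk₀⟩ := exists_dist_eq_idist X circ v
  have hex : ∀ k : ZMod n, ∃ t : ℤ, circ (k₀ + (t : ZMod n)) = circ k := fun k =>
    ⟨(k - k₀).valMinAbs, by rw [ZMod.coe_valMinAbs, add_sub_cancel]⟩
  have hdist : ∀ x, ∃ t : ℤ, X.dist x (circ (k₀ + (t : ZMod n))) = idist X circ x := by
    intro x
    obtain ⟨k, hk⟩ := exists_dist_eq_idist X circ x
    obtain ⟨t, ht⟩ := hex k
    exact ⟨t, by rw [ht, hk]⟩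
  have hmem : ∀ x, x ∈ (gnbhd X (Set.range circ) δ)ᶜ ↔ ⌊δ⌋₊ < idist X circ x := by
    intro x
    rw [Set.mem_compl_iff, mem_gnbhd_range _ _ hδ, not_le]
  refine ⟨fun t => circ (k₀ + (t : ZMod n)), ?_, ?_, ?_, ?_, ?_⟩
  · exact fun t t' h => hC.exists_param hlam k₀ hw t t' h
  · intro x hx
    obtain ⟨t, ht⟩ := hdist x
    exact ⟨t, ht.trans_le (hmax x (hfin.mem_toFinset.1 hx))⟩
  · intro x hx
    rw [mem_innerBdry, hfin.mem_toFinset] at hx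
    obtain ⟨hxA, y, hy, hadj⟩ := hx
    rw [hfin.mem_toFinset] at hy
    obtain ⟨t, ht⟩ := hdist x
    refine ⟨t, ht.trans_le ?_⟩
    have h1 : ¬ ⌊δ⌋₊ < idist X circ y := fun h => hy (hA.mem_of_adj hxA hadj ((hmem y).2 h))
    have h2 := idist_le_add hX.conn circ x y
    rw [dist_eq_one_iff_adj.2 hadj] at h2
    omega
  · simpa using hk₀.le
  · intro u hu
    rw [hX.mem_fball] at hu
    rw [hfin.mem_toFinset]
    refine hA.ball_subset hX hv (fun y hy => (hmem y).2 ?_) hu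
    have := idist_le_add hX.conn circ v y
    omega

theorem statement_14 {V : Type*} (X : SimpleGraph V)
    (hinf : Infinite V) (hconn : X.Connected)
    (hlf : ∀ v : V, (X.neighborSet v).Finite)
    (htrans : ∀ u v : V, ∃ φ : X ≃g X, φ u = v)
    (σ : ℝ) (hσ : 0 < σ) (hubq : UBQ X σ)
    (hng : ¬ QuadGrowth X) :
    ∀ lam c : ℝ, 1 ≤ lam → 0 ≤ c → ∀ δ : ℝ, 0 ≤ δ →
      ∃ C : ℝ, 0 ≤ C ∧ ∀ (n : ℕ) (circ : ZMod n → V),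
        IsQuasiCircle X lam c n circ →
        ∀ A : Set V, IsCompOf X A ((gnbhd X (Set.range circ) δ)ᶜ) → A.Finite →
          gdepth X A < C := by
  intro lam c hlam hc δ hδ
  have hX := niceGraph_of hinf hconn hlf htrans
  obtain ⟨K, T, hT, hK, hG⟩ := hX.isop_and_growth hσ hubq hng 64
  obtain ⟨R₀, hR₀⟩ := hX.not_fills hT hK hG (⌊δ⌋₊ + 1)
  obtain ⟨B, hB⟩ := exists_nat_ge (3 * lam + lam * c + 1)
  refine ⟨(R₀ + 2 * ⌊δ⌋₊ + B + 3 : ℕ), Nat.cast_nonneg _, ?_⟩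
  intro n circ hC A hA hfin
  by_contra! hdepth
  have hn : NeZero n := ⟨by have := hC.1; omega⟩
  obtain ⟨v, hv, hmax⟩ := hfin.exists_maximalFor (idist X circ) A hA.2.1
  replace hmax : ∀ x ∈ A, idist X circ x ≤ idist X circ v := fun x hx =>
    (le_total (idist X circ x) (idist X circ v)).elim id fun h => hmax hx h
  have hnot : ∀ k, circ k ∉ A := fun k hk => hA.1 hk ⟨circ k, ⟨k, rfl⟩, by simpa using hδ⟩
  have hR : R₀ + 2 * ⌊δ⌋₊ + B + 3 ≤ idist X circ v := by
    exact_mod_cast hdepth.trans (gdepth_le hX.conn hnot hmax)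
  have hRB : (B : ℝ) ≤ idist X circ v := by exact_mod_cast (by omega : B ≤ idist X circ v)
  have hR1 : (1 : ℝ) ≤ idist X circ v := by exact_mod_cast (by omega : 1 ≤ idist X circ v)
  have hw : lam * (3 * (idist X circ v : ℕ) + c) ≤ ((idist X circ v ^ 2 : ℕ) : ℝ) := by
    push_cast
    have h0 : 0 ≤ lam * c := mul_nonneg (by linarith) hc
    nlinarith
  obtain ⟨c', hc'⟩ := hC.fills hX hlam hδ hA hfin hv hmax hw (by omega)
  exact hR₀ _ (by omega) _ c' v hc'
end
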